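/- arXiv:2204.03677 — 4 statements merged into one kernel-verified Lean document; each statement's English description precedes it below -/
import Mathlib

section
/- Assume the configuration setup below, and let U = {x ∈ ℂⁿ : sinh⟨γ,x⟩ ≠ 0 for all γ ∈ R₊}. Suppose ψ : ℂⁿ × U → ℂ is such that for each x ∈ U one has ψ(z,x) = P(z,x)·exp⟨z,x⟩, where P(·,x) ∈ ℂ[z₁,…,zₙ] has total degree N and homogeneous component of degree N equal to ∏_{γ∈R₊} ⟨γ,z⟩^{m_γ}, the function ψ(·,x) satisfies the quasi-invariance conditions for (R₊, m), and for each fixed z ∈ ℂⁿ the map x ↦ ψ(z,x) is analytic on U. Then ψ is an eigenfunction of the generalised Calogero–Moser–Sutherland operator: for every x ∈ U and every z ∈ ℂⁿ, ∑_{i=1}^n ∂²ψ/∂x_i²(z,x) − ∑_{γ∈R₊} m_γ(m_γ + 2m_{2γ} + 1)·γ²·sinh^{−2}⟨γ,x⟩ · ψ(z,x) = ⟨z,z⟩·ψ(z,x). -/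
/-- The bilinear extension of the Euclidean inner product on `ℂⁿ`. -/
noncomputable def bil {n : ℕ} (z w : Fin n → ℂ) : ℂ := ∑ i, z i * w i

/-- The linear form `z ↦ ⟨α, z⟩` as a polynomial in `z₁, …, zₙ`. -/
noncomputable def linForm {n : ℕ} (α : Fin n → ℂ) : MvPolynomial (Fin n) ℂ :=
  ∑ i, MvPolynomial.C (α i) * MvPolynomial.X i

/-- `ψ` satisfies the quasi-invariance conditions for the configuration
`(R₊, m)` (with derived multiplicities `m₂` for the doubled vectors). -/
def QuasiInv {n : ℕ} (R : Finset (Fin n → ℂ)) (mult mult2 : (Fin n → ℂ) → ℕ)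
    (ψ : (Fin n → ℂ) → ℂ) : Prop :=
  ∀ α ∈ R, (2⁻¹ : ℂ) • α ∉ R →
    ∀ s : ℕ,
      ((1 ≤ s ∧ s ≤ mult α) ∨ (∃ t : ℕ, 1 ≤ t ∧ t ≤ mult2 α ∧ s = mult α + 2 * t)) →
      ∀ z : Fin n → ℂ, bil α z = 0 →
        ψ (z + (s : ℂ) • α) = ψ (z - (s : ℂ) • α)


section OneDim
open Polynomial

def SS (m m2 s : ℕ) : Prop :=
  (1 ≤ s ∧ s ≤ m) ∨ (∃ t : ℕ, 1 ≤ t ∧ t ≤ m2 ∧ s = m + 2 * t)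

noncomputable def ee (x a : ℂ) : PowerSeries ℂ :=
  PowerSeries.C (Complex.exp (a * x)) * PowerSeries.rescale a (PowerSeries.exp ℂ)

theorem ee_mul (x a b : ℂ) : ee x a * ee x b = ee x (a + b) := by
  unfold ee
  rw [← PowerSeries.exp_mul_exp_eq_exp_add, add_mul, Complex.exp_add, map_mul]
  ring

theorem ee_coeff (x a : ℂ) (k : ℕ) :
    PowerSeries.coeff k (ee x a) = Complex.exp (a * x) * (a ^ k / (k.factorial : ℂ)) := by
  unfold ee
  rw [PowerSeries.coeff_C_mul, PowerSeries.coeff_rescale, PowerSeries.coeff_exp]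
  simp [div_eq_mul_inv]

noncomputable def Lam (f : ℂ[X]) : PowerSeries ℂ →ₗ[ℂ] ℂ :=
  ∑ k ∈ Finset.range (f.natDegree + 1),
    (f.coeff k * (k.factorial : ℂ)) • (PowerSeries.coeff k : PowerSeries ℂ →ₗ[ℂ] ℂ)

theorem Lam_ee (f : ℂ[X]) (x a : ℂ) : Lam f (ee x a) = f.eval a * Complex.exp (a * x) := by
  unfold Lam
  rw [eval_eq_sum_range, Finset.sum_mul]
  simp only [LinearMap.sum_apply, LinearMap.smul_apply, ee_coeff, smul_eq_mul]
  refine Finset.sum_congr rfl fun k _ => ?_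
  have : (k.factorial : ℂ) ≠ 0 := by exact_mod_cast k.factorial_ne_zero
  field_simp

noncomputable def psS (x : ℂ) : PowerSeries ℂ := (2⁻¹ : ℂ) • (ee x 1 - ee x (-1))
noncomputable def psC (x : ℂ) : PowerSeries ℂ := (2⁻¹ : ℂ) • (ee x 1 + ee x (-1))

theorem psC_mul (x : ℂ) (s : ℂ) : psC x * (ee x s - ee x (-s)) =
    (2⁻¹ : ℂ) • ((ee x (s + 1) - ee x (-(s + 1))) + (ee x (s - 1) - ee x (-(s - 1)))) := by
  unfold psC
  rw [smul_mul_assoc, add_mul, mul_sub, mul_sub, ee_mul, ee_mul, ee_mul, ee_mul]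
  congr 1
  ring_nf

theorem kill (x : ℂ) (k : ℕ) : ∀ (Λ : PowerSeries ℂ →ₗ[ℂ] ℂ),
    (∀ s : ℕ, 1 ≤ s → s ≤ k + 1 → s % 2 = (k + 1) % 2 → Λ (ee x s - ee x (-s)) = 0) →
    Λ (psS x * psC x ^ k) = 0 := by
  induction k with
  | zero =>
    intro Λ h
    have := h 1 le_rfl le_rfl rfl
    unfold psS
    simp only [pow_zero, mul_one, map_smul]
    rw [Nat.cast_one] at this
    rw [this]; simp
  | succ k ih =>
    intro Λ h
    have := ih (Λ ∘ₗ (LinearMap.mulLeft ℂ (psC x))) ?_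
    · simp only [LinearMap.comp_apply, LinearMap.mulLeft_apply] at this
      rw [← this]; congr 1; ring
    · intro s h1 h2 h3
      simp only [LinearMap.comp_apply, LinearMap.mulLeft_apply]
      rw [psC_mul, map_smul, map_add]
      have e1 := h (s + 1) (by omega) (by omega) (by omega)
      push_cast at e1
      rw [e1]
      by_cases hs : s = 1
      · subst hs; simp
      · have e2 := h (s - 1) (by omega) (by omega) (by omega)
        rw [Nat.cast_sub h1] at e2
        push_cast at e2
        rw [e2]; simp

theorem exists_h0 (c : ℂ) (hc : c ≠ 0) (m2 : ℕ) : ∃ h r : ℂ[X],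
    h = (X - C c) ^ m2 * r ∧ r.eval c ≠ 0 ∧
    r.derivative.eval c * ((m2 + 1) * (2 * c)) = (m2 + 1) * (m2 + 2) * r.eval c ∧
    ∀ k, h.coeff k ≠ 0 → ∃ t, t ≤ m2 ∧ k = 1 + 2 * t := by
  refine ⟨X * (X ^ 2 - C (c ^ 2)) ^ m2, X * (X + C c) ^ m2, ?_, ?_, ?_, ?_⟩
  · rw [show (X ^ 2 - C (c ^ 2) : ℂ[X]) = (X - C c) * (X + C c) by rw [C_pow]; ring, mul_pow]; ring
  · simp [hc]
  · cases m2 with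
    | zero => simp
    | succ k =>
      simp [derivative_pow]
      ring
  · intro k hk
    have : (X * (X ^ 2 - C (c ^ 2)) ^ m2 : ℂ[X]) = X * expand ℂ 2 ((X - C (c ^ 2)) ^ m2) := by
      simp
    rw [this] at hk
    cases k with
    | zero => simp at hk
    | succ k =>
      rw [coeff_X_mul, coeff_expand (by norm_num)] at hk
      split_ifs at hk with h2
      · obtain ⟨t, rfl⟩ := h2
        refine ⟨t, ?_, by ring⟩
        by_contra hlt
        apply hk
        apply coeff_eq_zero_of_natDegree_lt
        rw [natDegree_pow, natDegree_X_sub_C]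
        omega
      · exact absurd rfl hk

theorem exists_anti (h : ℂ[X]) (c : ℂ) : ∃ H : ℂ[X], H.derivative = h ∧ H.eval c = 0 ∧
    ∀ k, H.coeff (k + 1) ≠ 0 → h.coeff k ≠ 0 := by
  let G : ℂ[X] := h.sum fun k a => monomial (k + 1) (a / (k + 1))
  have hG : G.derivative = h := by
    simp only [G, Polynomial.sum, derivative_sum, derivative_monomial]
    conv_rhs => rw [h.as_sum_support]
    refine Finset.sum_congr rfl fun k _ => ?_
    have : (k + 1 : ℂ) ≠ 0 := by exact_mod_cast k.succ_ne_zero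
    simp
    field_simp
  refine ⟨G - C (G.eval c), by simp [hG], by simp, ?_⟩
  intro k hk hk2
  apply hk
  have := congrArg (fun p => p.coeff k) hG
  simp only [coeff_derivative, hk2] at this
  have h1 : (k + 1 : ℂ) ≠ 0 := by exact_mod_cast k.succ_ne_zero
  have := (mul_eq_zero.mp this).resolve_right h1
  simp [this]

theorem anti_step (c : ℂ) (a : ℕ) (H r : ℂ[X]) (hH : H.derivative = (X - C c) ^ a * r)
    (h0 : H.eval c = 0) (hr : r.eval c ≠ 0) :
    ∃ R : ℂ[X], H = (X - C c) ^ (a + 1) * R ∧ (a + 1) * R.eval c = r.eval c ∧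
      (a + 2) * R.derivative.eval c = r.derivative.eval c := by
  have hr0 : r ≠ 0 := by rintro rfl; simp at hr
  have hX : (X - C c) ≠ 0 := X_sub_C_ne_zero c
  have hne : (X - C c) ^ a * r ≠ 0 := mul_ne_zero (pow_ne_zero _ hX) hr0
  have hH0 : H ≠ 0 := by rintro rfl; rw [derivative_zero] at hH; exact hne hH.symm
  have h1 := derivative_rootMultiplicity_of_root (p := H) (t := c) h0
  have h2 : a ≤ H.derivative.rootMultiplicity c := by
    rw [le_rootMultiplicity_iff (by rw [hH]; exact hne), hH]
    exact dvd_mul_right _ _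
  have h3 : 0 < H.rootMultiplicity c := (rootMultiplicity_pos hH0).2 h0
  obtain ⟨R, hR⟩ := (le_rootMultiplicity_iff (n := a + 1) hH0 (a := c)).1 (by omega)
  have h4 : (a + 1 : ℂ[X]) * R + (X - C c) * R.derivative = r := by
    apply mul_left_cancel₀ (pow_ne_zero a hX)
    rw [← hH, hR]
    simp [derivative_pow]
    ring
  refine ⟨R, hR, ?_, ?_⟩
  · rw [← h4]; simp
  · rw [← h4]; simp; ring

theorem exists_h (c : ℂ) (m m2 : ℕ) (hc : m2 ≠ 0 → c ≠ 0) (M' : ℕ) (hM : m + m2 = M' + 1) :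
    ∃ h r : ℂ[X],
    h = (X - C c) ^ M' * r ∧ r.eval c ≠ 0 ∧
    r.derivative.eval c * ((M' + 1) * (2 * c)) = m2 * (m2 + 1) * r.eval c ∧
    (m2 = 0 → r.derivative.eval c = 0) ∧
    ∀ k, h.coeff k ≠ 0 → k < m ∨ ∃ t, 1 ≤ t ∧ t ≤ m2 ∧ k + 1 = m + 2 * t := by
  by_cases h2 : m2 = 0
  · subst h2
    refine ⟨(X - C c) ^ M', 1, by simp, by simp, by simp, by simp, ?_⟩
    intro k hk
    left
    by_contra hlt
    apply hk
    apply coeff_eq_zero_of_natDegree_lt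
    simp
    omega
  · obtain ⟨q, rfl⟩ := Nat.exists_eq_succ_of_ne_zero h2
    specialize hc h2
    suffices H : ∃ h r : ℂ[X], h = (X - C c) ^ (m + q) * r ∧ r.eval c ≠ 0 ∧
      r.derivative.eval c * (((m + q : ℕ) + 1) * (2 * c)) = (q + 1) * (q + 2) * r.eval c ∧
      ∀ k, h.coeff k ≠ 0 → k < m ∨ ∃ t, t ≤ q ∧ k = m + 1 + 2 * t by
      obtain ⟨h, r, e1, e2, e3, e4⟩ := H
      obtain rfl : M' = m + q := by omega
      refine ⟨h, r, e1, e2, ?_, by simp, ?_⟩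
      · rw [e3]; push_cast; ring
      · intro k hk
        rcases e4 k hk with h | ⟨t, ht, h⟩
        · exact Or.inl h
        · exact Or.inr ⟨t + 1, by omega, by omega, by omega⟩
    clear hM
    induction m with
    | zero =>
      obtain ⟨h, r, e1, e2, e3, e4⟩ := exists_h0 c hc q
      refine ⟨h, r, by simpa using e1, e2, by simpa using e3, ?_⟩
      intro k hk
      obtain ⟨t, ht, h⟩ := e4 k hk
      exact Or.inr ⟨t, ht, by omega⟩
    | succ m ih =>
      obtain ⟨h, r, e1, e2, e3, e4⟩ := ih
      obtain ⟨H, f1, f2, f3⟩ := exists_anti h c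
      obtain ⟨R, g1, g2, g3⟩ := anti_step c (m + q) H r (by rw [f1, e1]) f2 e2
      refine ⟨H, R, by rw [g1]; congr 2; omega, ?_, ?_, ?_⟩
      · intro h; apply e2; rw [← g2, h, mul_zero]
      · rw [← g2, ← g3] at e3
        have : (((m + q : ℕ) : ℂ) + 1) ≠ 0 := by exact_mod_cast (m + q).succ_ne_zero
        apply mul_left_cancel₀ this
        push_cast at e3 ⊢
        linear_combination e3
      · intro k hk
        cases k with
        | zero => left; omega
        | succ k =>
          rcases e4 k (f3 k hk) with h | ⟨t, ht, h⟩
          · left; omega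
          · exact Or.inr ⟨t, ht, by omega⟩

theorem Lam_eq (f : ℂ[X]) (L : ℕ) (hL : f.natDegree < L) (G : PowerSeries ℂ) :
    Lam f G = ∑ k ∈ Finset.range L, f.coeff k * (k.factorial : ℂ) * PowerSeries.coeff k G := by
  unfold Lam
  simp only [LinearMap.sum_apply, LinearMap.smul_apply, smul_eq_mul]
  apply Finset.sum_subset
  · intro k hk; simp at hk ⊢; omega
  · intro k _ hk
    rw [coeff_eq_zero_of_natDegree_lt]
    · simp
    · simp at hk; omega

theorem Lam_X_pow (f : ℂ[X]) (M' : ℕ) (hd : f.natDegree ≤ M' + 1) (W : PowerSeries ℂ) :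
    Lam f (PowerSeries.X ^ M' * W) = f.coeff M' * (M'.factorial : ℂ) * PowerSeries.coeff 0 W +
      f.coeff (M' + 1) * ((M' + 1).factorial : ℂ) * PowerSeries.coeff 1 W := by
  rw [Lam_eq f (M' + 2) (by omega), Finset.sum_range_succ, Finset.sum_range_succ]
  rw [Finset.sum_eq_zero]
  · rw [PowerSeries.coeff_X_pow_mul', PowerSeries.coeff_X_pow_mul']
    simp
  · intro k hk
    rw [PowerSeries.coeff_X_pow_mul', if_neg (by simpa using hk)]
    simp

theorem ps_one_mul (A B : PowerSeries ℂ) : PowerSeries.coeff 1 (A * B) =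
    PowerSeries.coeff 0 A * PowerSeries.coeff 1 B + PowerSeries.coeff 1 A * PowerSeries.coeff 0 B := by
  rw [PowerSeries.coeff_mul]
  simp [Finset.Nat.antidiagonal_succ]

theorem ps_zero_mul (A B : PowerSeries ℂ) : PowerSeries.coeff 0 (A * B) =
    PowerSeries.coeff 0 A * PowerSeries.coeff 0 B := by
  simp

theorem ps_zero_aeval (A : PowerSeries ℂ) (r : ℂ[X]) : PowerSeries.coeff 0 (aeval A r) =
    r.eval (PowerSeries.coeff 0 A) := by
  induction r using Polynomial.induction_on' with
  | add p q hp hq => simp only [map_add, hp, hq, eval_add]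
  | monomial k a =>
    rw [aeval_monomial, eval_monomial, ps_zero_mul]
    simp

theorem ps_one_aeval (A : PowerSeries ℂ) (r : ℂ[X]) : PowerSeries.coeff 1 (aeval A r) =
    r.derivative.eval (PowerSeries.coeff 0 A) * PowerSeries.coeff 1 A := by
  induction r using Polynomial.induction_on' with
  | add p q hp hq => simp only [map_add, hp, hq, eval_add, add_mul]
  | monomial k a =>
    rw [aeval_monomial, derivative_monomial, eval_monomial, ps_one_mul, PowerSeries.coeff_one_pow]
    rw [PowerSeries.algebraMap_apply]
    simp
    ring

theorem psS0 (x : ℂ) : PowerSeries.coeff 0 (psS x) = Complex.sinh x := by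
  simp only [psS, map_smul, map_sub, ee_coeff, Complex.sinh]; simp; ring
theorem psS1 (x : ℂ) : PowerSeries.coeff 1 (psS x) = Complex.cosh x := by
  simp only [psS, map_smul, map_sub, ee_coeff, Complex.cosh]; simp; ring
theorem psC0 (x : ℂ) : PowerSeries.coeff 0 (psC x) = Complex.cosh x := by
  simp only [psC, map_smul, map_add, ee_coeff, Complex.cosh]; simp; ring
theorem psC1 (x : ℂ) : PowerSeries.coeff 1 (psC x) = Complex.sinh x := by
  simp only [psC, map_smul, map_add, ee_coeff, Complex.sinh]; simp; ring
theorem psC2 (x : ℂ) : PowerSeries.coeff 2 (psC x) = Complex.cosh x / 2 := by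
  simp only [psC, map_smul, map_add, ee_coeff, Complex.cosh]; simp; ring

theorem exists_v (x : ℂ) : ∃ v : PowerSeries ℂ, psC x - PowerSeries.C (Complex.cosh x) =
    PowerSeries.X * v ∧ PowerSeries.coeff 0 v = Complex.sinh x ∧
    PowerSeries.coeff 1 v = Complex.cosh x / 2 := by
  obtain ⟨v, hv⟩ : PowerSeries.X ∣ psC x - PowerSeries.C (Complex.cosh x) := by
    rw [PowerSeries.X_dvd_iff, ← PowerSeries.coeff_zero_eq_constantCoeff_apply, map_sub, psC0]
    simp
  refine ⟨v, hv, ?_, ?_⟩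
  · have := congrArg (PowerSeries.coeff 1) hv
    rw [show (1 : ℕ) = 0 + 1 from rfl, PowerSeries.coeff_succ_X_mul, map_sub, psC1,
      PowerSeries.coeff_C] at this
    simpa using this.symm
  · have := congrArg (PowerSeries.coeff 2) hv
    rw [show (2 : ℕ) = 1 + 1 from rfl, PowerSeries.coeff_succ_X_mul, map_sub, psC2,
      PowerSeries.coeff_C] at this
    simpa using this.symm

theorem one_dim (x : ℂ) (m m2 M' : ℕ) (hM : m + m2 = M' + 1) (hs : Complex.sinh x ≠ 0)
    (hc : m2 ≠ 0 → Complex.cosh x ≠ 0) (f : ℂ[X]) (hd : f.natDegree ≤ M' + 1)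
    (hf : ∀ s : ℕ, SS m m2 s → f.eval (s : ℂ) * Complex.exp (s * x) =
      f.eval (-(s : ℂ)) * Complex.exp (-s * x)) :
    f.coeff M' = - f.coeff (M' + 1) * ((M' + 1) * (M' + 2) / 2 * (Complex.cosh x / Complex.sinh x) +
      m2 * (m2 + 1) / 2 * (Complex.sinh x / Complex.cosh x)) := by
  obtain ⟨h, r, e1, e2, e3, e3', e4⟩ := exists_h (Complex.cosh x) m m2 hc M' hM
  have key : Lam f (psS x * aeval (psC x) h) = 0 := by
    rw [aeval_eq_sum_range, Finset.mul_sum, map_sum]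
    refine Finset.sum_eq_zero fun k _ => ?_
    rw [mul_smul_comm, map_smul]
    by_cases hk : h.coeff k = 0
    · rw [hk, zero_smul]
    · rw [kill x k, smul_zero]
      intro s h1 h2 h3
      rw [map_sub, Lam_ee, Lam_ee, sub_eq_zero]
      apply hf
      rcases e4 k hk with h | ⟨t, ht1, ht2, h⟩
      · left; omega
      · by_cases hsm : s ≤ m
        · exact Or.inl ⟨h1, hsm⟩
        · exact Or.inr ⟨(s - m) / 2, by omega, by omega, by omega⟩
  obtain ⟨v, hv, v0, v1⟩ := exists_v x
  have e5 : psS x * aeval (psC x) h =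
      PowerSeries.X ^ M' * (psS x * (v ^ M' * aeval (psC x) r)) := by
    rw [e1, map_mul, map_pow, map_sub, aeval_X, aeval_C, PowerSeries.algebraMap_apply]
    simp only [Algebra.algebraMap_self, RingHom.id_apply]
    rw [hv, mul_pow]; ring
  rw [e5, Lam_X_pow f M' hd] at key
  simp only [ps_zero_mul, ps_one_mul, ps_zero_aeval, ps_one_aeval, psS0, psS1, psC0, psC1,
    PowerSeries.coeff_one_pow] at key
  have hp : PowerSeries.coeff 0 (v ^ M') = Complex.sinh x ^ M' := by
    rw [← v0]; simp
  rw [hp] at key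
  rw [← PowerSeries.coeff_zero_eq_constantCoeff_apply, v0, v1, Nat.factorial_succ] at key
  have hfac : (M'.factorial : ℂ) ≠ 0 := by exact_mod_cast M'.factorial_ne_zero
  have hMp : (M' : ℂ) + 1 ≠ 0 := by exact_mod_cast M'.succ_ne_zero
  set S := Complex.sinh x
  set Cc := Complex.cosh x
  set r0 := r.eval Cc
  set r1 := r.derivative.eval Cc
  have hr1 : (M' + 1) * r1 = m2 * (m2 + 1) / 2 * r0 / Cc := by
    by_cases h2 : m2 = 0
    · rw [e3' h2, h2]; simp
    · have := hc h2
      field_simp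
      linear_combination e3
  have hpow : (M' : ℂ) * S ^ (M' - 1) * S = M' * S ^ M' := by
    cases M' with
    | zero => simp
    | succ k => simp [pow_succ]; ring
  have hne : (M'.factorial : ℂ) * S ^ M' * S * r0 ≠ 0 :=
    mul_ne_zero (mul_ne_zero (mul_ne_zero hfac (pow_ne_zero _ hs)) hs) e2
  apply mul_left_cancel₀ hne
  have hk : Cc / S * S = Cc := div_mul_cancel₀ _ hs
  push_cast at key
  linear_combination key - f.coeff (M' + 1) * (M' + 1) * M'.factorial * Cc / 2 * r0 * hpow -
    f.coeff (M' + 1) * M'.factorial * S ^ 2 * S ^ M' * hr1 +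
    f.coeff (M' + 1) * M'.factorial * S ^ M' * r0 * ((M' + 1) * (M' + 2) / 2) * hk

theorem SS_sub (m m2 K : ℕ) (hK : K < m + m2) : ∃ a b : ℕ, a + b = K + 1 ∧ b ≤ m2 ∧
    ∀ s, SS a b s → SS m m2 s := by
  by_cases h : K + 1 ≤ m
  · refine ⟨K + 1, 0, rfl, by omega, ?_⟩
    rintro s (⟨h1, h2⟩ | ⟨t, h1, h2, h3⟩)
    · exact Or.inl ⟨h1, by omega⟩
    · omega
  · refine ⟨m, K + 1 - m, by omega, by omega, ?_⟩
    rintro s (⟨h1, h2⟩ | ⟨t, h1, h2, h3⟩)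
    · exact Or.inl ⟨h1, by omega⟩
    · exact Or.inr ⟨t, h1, by omega, h3⟩

theorem one_dim_zero (x : ℂ) (m m2 : ℕ) (hs : Complex.sinh x ≠ 0)
    (hc : m2 ≠ 0 → Complex.cosh x ≠ 0) (f : ℂ[X]) (hd : ∀ k, m + m2 ≤ k → f.coeff k = 0)
    (hf : ∀ s : ℕ, SS m m2 s → f.eval (s : ℂ) * Complex.exp (s * x) =
      f.eval (-(s : ℂ)) * Complex.exp (-s * x)) : f = 0 := by
  have main : ∀ j, j ≤ m + m2 → ∀ k, m + m2 - j ≤ k → f.coeff k = 0 := by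
    intro j
    induction j with
    | zero => intro _ k hk; exact hd k (by omega)
    | succ j ih =>
      intro hj k hk
      by_cases hk' : m + m2 - j ≤ k
      · exact ih (by omega) k hk'
      · obtain ⟨a, b, h1, h2, h3⟩ := SS_sub m m2 k (by omega)
        have := one_dim x a b k h1 hs (fun hb => hc (by omega)) f
          (natDegree_le_iff_coeff_eq_zero.2 fun i hi => ih (by omega) i (by omega))
          (fun s hs => hf s (h3 s hs))
        rw [this, ih (by omega) (k + 1) (by omega)]
        simp
  ext k
  simpa using main (m + m2) le_rfl k (by omega)

end OneDim

section MultiDim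
open Polynomial

variable {n : ℕ}

noncomputable def rho (α w : Fin n → ℂ) : MvPolynomial (Fin n) ℂ →ₐ[ℂ] ℂ[X] :=
  MvPolynomial.aeval fun i => C (w i) + C (α i) * X

theorem rho_eval (α w : Fin n → ℂ) (t : ℂ) (T : MvPolynomial (Fin n) ℂ) :
    (rho α w T).eval t = MvPolynomial.eval (w + t • α) T := by
  unfold rho
  induction T using MvPolynomial.induction_on with
  | C a => simp
  | add p q hp hq => simp only [map_add, eval_add, hp, hq]
  | mul_X p i hp => simp only [map_mul, eval_mul, hp]; simp; left; ring

theorem bil_smul_right (a b : Fin n → ℂ) (t : ℂ) : bil a (t • b) = t * bil a b := by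
  unfold bil; rw [Finset.mul_sum]; exact Finset.sum_congr rfl fun i _ => by simp; ring
theorem bil_smul_left (a b : Fin n → ℂ) (t : ℂ) : bil (t • a) b = t * bil a b := by
  unfold bil; rw [Finset.mul_sum]; exact Finset.sum_congr rfl fun i _ => by simp; ring
theorem bil_add_right (a b c : Fin n → ℂ) : bil a (b + c) = bil a b + bil a c := by
  unfold bil; rw [← Finset.sum_add_distrib]; exact Finset.sum_congr rfl fun i _ => by simp; ring
theorem bil_add_left (a b c : Fin n → ℂ) : bil (a + b) c = bil a c + bil b c := by
  unfold bil; rw [← Finset.sum_add_distrib]; exact Finset.sum_congr rfl fun i _ => by simp; ring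
theorem bil_comm (a b : Fin n → ℂ) : bil a b = bil b a := by
  unfold bil; exact Finset.sum_congr rfl fun i _ => by ring

theorem linForm_eval (α z : Fin n → ℂ) : MvPolynomial.eval z (linForm α) = bil α z := by
  simp [linForm, bil]

theorem rho_linForm (α β w : Fin n → ℂ) :
    rho α w (linForm β) = C (bil β w) + C (bil β α) * X := by
  apply Polynomial.funext
  intro t
  rw [rho_eval, linForm_eval, bil_add_right, bil_smul_right]
  simp; ring

theorem rho_natDegree (α w : Fin n → ℂ) (T : MvPolynomial (Fin n) ℂ) (d : ℕ)
    (h : T.totalDegree ≤ d) : (rho α w T).natDegree ≤ d := by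
  have := MvPolynomial.aeval_natDegree_le (m := d) (n := 1) T h
    (fun i => C (w i) + C (α i) * X) (fun i => by compute_degree)
  simpa [rho] using this

theorem homog_eval_smul (T : MvPolynomial (Fin n) ℂ) (d : ℕ) (hT : T.IsHomogeneous d) (t : ℂ)
    (z : Fin n → ℂ) : MvPolynomial.eval (t • z) T = t ^ d * MvPolynomial.eval z T := by
  rw [MvPolynomial.eval_eq, MvPolynomial.eval_eq, Finset.mul_sum]
  refine Finset.sum_congr rfl fun μ hμ => ?_
  have h1 : μ.degree = d := (hT.degree_eq_sum_deg_support hμ).symm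
  rw [← h1, Finsupp.degree_apply]
  simp only [Pi.smul_apply, smul_eq_mul, mul_pow, Finset.prod_mul_distrib, Finset.prod_pow_eq_pow_sum]
  ring

theorem homog_rho (T : MvPolynomial (Fin n) ℂ) (d : ℕ) (hT : T.IsHomogeneous d) (l s : ℂ)
    (hl : l ≠ 0) (α w : Fin n → ℂ) : MvPolynomial.eval (l • w + s • α) T =
      ∑ k ∈ Finset.range (d + 1), l ^ (d - k) * (s ^ k * (rho α w T).coeff k) := by
  have h1 : l • w + s • α = l • (w + (s / l) • α) := by
    rw [smul_add, smul_smul, mul_div_cancel₀ _ hl]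
  rw [h1, homog_eval_smul T d hT, ← rho_eval,
    eval_eq_sum_range' (Nat.lt_succ_of_le (rho_natDegree α w T d hT.totalDegree_le)), Finset.mul_sum]
  refine Finset.sum_congr rfl fun k hk => ?_
  have hk : k ≤ d := by simp at hk; omega
  obtain ⟨e, rfl⟩ := Nat.exists_eq_add_of_le hk
  rw [div_pow, Nat.add_sub_cancel_left, pow_add]
  field_simp

theorem coef_zero (L : ℕ) (a : ℕ → ℂ)
    (h : ∀ l : ℂ, l ≠ 0 → ∑ j ∈ Finset.range L, l ^ j * a j = 0) : ∀ j < L, a j = 0 := by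
  have : X * (∑ j ∈ Finset.range L, C (a j) * X ^ j) = 0 := by
    apply Polynomial.funext
    intro l
    by_cases hl : l = 0
    · simp [hl]
    · rw [eval_mul, eval_finsetSum]
      have := h l hl
      simp only [eval_mul, eval_C, eval_pow, eval_X, eval_zero]
      rw [Finset.sum_congr rfl fun j _ => mul_comm (a j) _, this, mul_zero]
  have := (mul_eq_zero.1 this).resolve_left X_ne_zero
  intro j hj
  have := congrArg (fun p => p.coeff j) this
  simpa [finsetSum_coeff, coeff_C_mul, coeff_X_pow, hj] using this

noncomputable def cc (Q : MvPolynomial (Fin n) ℂ) (α w : Fin n → ℂ) (d k : ℕ) : ℂ :=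
  (rho α w (MvPolynomial.homogeneousComponent d Q)).coeff k

theorem cc_zero (Q : MvPolynomial (Fin n) ℂ) (α w : Fin n → ℂ) (d k : ℕ)
    (h : Q.totalDegree < d) : cc Q α w d k = 0 := by
  rw [cc, MvPolynomial.homogeneousComponent_eq_zero _ _ h]; simp

theorem cc_zero' (Q : MvPolynomial (Fin n) ℂ) (α w : Fin n → ℂ) (d k : ℕ)
    (h : d < k) : cc Q α w d k = 0 := by
  rw [cc]
  apply coeff_eq_zero_of_natDegree_lt
  exact lt_of_le_of_lt (rho_natDegree _ _ _ d
    (MvPolynomial.homogeneousComponent_isHomogeneous d Q).totalDegree_le) h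

noncomputable def fj (Q : MvPolynomial (Fin n) ℂ) (α w : Fin n → ℂ) (D j : ℕ) : ℂ[X] :=
  ∑ k ∈ Finset.range (D + 1), C (cc Q α w (j + k) k) * X ^ k

theorem fj_coeff (Q : MvPolynomial (Fin n) ℂ) (α w : Fin n → ℂ) (D j k : ℕ)
    (hD : Q.totalDegree ≤ D) : (fj Q α w D j).coeff k = cc Q α w (j + k) k := by
  rw [fj, finsetSum_coeff]
  simp only [coeff_C_mul, coeff_X_pow, mul_ite, mul_one, mul_zero, Finset.sum_ite_eq,
    Finset.mem_range]
  split_ifs with h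
  · rfl
  · rw [cc_zero]; omega

theorem eval_expand (Q : MvPolynomial (Fin n) ℂ) (α w : Fin n → ℂ) (D : ℕ)
    (hD : Q.totalDegree ≤ D) (l s : ℂ) (hl : l ≠ 0) :
    MvPolynomial.eval (l • w + s • α) Q =
      ∑ j ∈ Finset.range (D + 1), l ^ j * (fj Q α w D j).eval s := by
  have h1 : Q = ∑ d ∈ Finset.range (D + 1), MvPolynomial.homogeneousComponent d Q := by
    conv_lhs => rw [← MvPolynomial.sum_homogeneousComponent Q]
    apply Finset.sum_subset
    · intro k hk; simp at hk ⊢; omega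
    · intro k _ hk
      apply MvPolynomial.homogeneousComponent_eq_zero
      simp at hk; omega
  conv_lhs => rw [h1]
  rw [map_sum]
  rw [Finset.sum_congr rfl fun d _ => homog_rho _ d
    (MvPolynomial.homogeneousComponent_isHomogeneous d Q) l s hl α w]
  rw [Finset.sum_comm' (t' := Finset.range (D + 1)) (s' := fun k => Finset.Ico k (D + 1))
    (by intro a b; simp; omega)]
  simp only [fj, eval_finsetSum, eval_mul, eval_C, eval_pow, eval_X, Finset.mul_sum]
  conv_rhs => rw [Finset.sum_comm]
  refine Finset.sum_congr rfl fun k hk => ?_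
  rw [Finset.sum_Ico_eq_sum_range]
  have : ∑ j ∈ Finset.range (D + 1), l ^ j * (cc Q α w (j + k) k * s ^ k) =
      ∑ j ∈ Finset.range (D + 1 - k), l ^ j * (cc Q α w (j + k) k * s ^ k) := by
    symm
    apply Finset.sum_subset
    · intro k hk; simp at hk ⊢; omega
    · intro j _ hj
      rw [cc_zero]
      · ring
      · simp at hj; omega
  rw [this]
  refine Finset.sum_congr rfl fun j hj => ?_
  rw [Nat.add_sub_cancel_left, cc, add_comm k j]
  ring

def QI (Q : MvPolynomial (Fin n) ℂ) (α : Fin n → ℂ) (m m2 : ℕ) (ξ : ℂ) : Prop :=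
  ∀ s : ℕ, SS m m2 s → ∀ w : Fin n → ℂ, bil α w = 0 →
    MvPolynomial.eval (w + (s : ℂ) • α) Q * Complex.exp (s * ξ) =
    MvPolynomial.eval (w - (s : ℂ) • α) Q * Complex.exp (-s * ξ)

theorem fj_QI (Q : MvPolynomial (Fin n) ℂ) (α w : Fin n → ℂ) (D j m m2 : ℕ) (ξ : ℂ)
    (hD : Q.totalDegree ≤ D) (hQ : QI Q α m m2 ξ) (hw : bil α w = 0) (s : ℕ) (hs : SS m m2 s) :
    (fj Q α w D j).eval (s : ℂ) * Complex.exp (s * ξ) =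
      (fj Q α w D j).eval (-(s : ℂ)) * Complex.exp (-s * ξ) := by
  by_cases hj : j < D + 1
  · have := coef_zero (D + 1) (fun j => (fj Q α w D j).eval (s : ℂ) * Complex.exp (s * ξ) -
      (fj Q α w D j).eval (-(s : ℂ)) * Complex.exp (-s * ξ)) ?_ j hj
    · exact sub_eq_zero.1 this
    · intro l hl
      have h := hQ s hs (l • w) (by rw [bil_smul_right, hw, mul_zero])
      rw [sub_eq_add_neg, ← neg_smul, eval_expand Q α w D hD _ _ hl,
        eval_expand Q α w D hD _ _ hl, ← sub_eq_zero, Finset.sum_mul, Finset.sum_mul,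
        ← Finset.sum_sub_distrib] at h
      rw [← h]
      exact Finset.sum_congr rfl fun j _ => by ring
  · have : fj Q α w D j = 0 := by
      ext k
      rw [fj_coeff _ _ _ _ _ _ hD, cc_zero _ _ _ _ _ (by omega)]; simp
    simp [this]

theorem cc_top (Q : MvPolynomial (Fin n) ℂ) (α w : Fin n → ℂ) (D m m2 : ℕ) (ξ : ℂ)
    (hs : Complex.sinh ξ ≠ 0) (hc : m2 ≠ 0 → Complex.cosh ξ ≠ 0)
    (hD : Q.totalDegree ≤ D) (hQ : QI Q α m m2 ξ) (hw : bil α w = 0) (k : ℕ) (hk : k < m + m2) :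
    cc Q α w D k = 0 := by
  by_cases hkD : k ≤ D
  · have := one_dim_zero ξ m m2 hs hc (fj Q α w D (D - k)) ?_
      (fun s h => fj_QI Q α w D _ m m2 ξ hD hQ hw s h)
    · have := congrArg (fun p => p.coeff k) this
      simp only [fj_coeff Q α w D _ _ hD, coeff_zero] at this
      rwa [Nat.sub_add_cancel hkD] at this
    · intro i hi
      rw [fj_coeff _ _ _ _ _ _ hD, cc_zero _ _ _ _ _ (by omega)]
  · exact cc_zero' _ _ _ _ _ (by omega)

theorem cc_sub (Q : MvPolynomial (Fin n) ℂ) (α w : Fin n → ℂ) (D m m2 : ℕ) (ξ : ℂ)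
    (hs : Complex.sinh ξ ≠ 0) (hc : m2 ≠ 0 → Complex.cosh ξ ≠ 0)
    (hD : Q.totalDegree ≤ D + 1) (hQ : QI Q α m m2 ξ) (hw : bil α w = 0) (k : ℕ)
    (hk : k + 1 < m + m2) : cc Q α w D k = 0 := by
  by_cases hkD : k ≤ D
  · have := one_dim_zero ξ m m2 hs hc (fj Q α w (D + 1) (D - k)) ?_
      (fun s h => fj_QI Q α w (D + 1) _ m m2 ξ hD hQ hw s h)
    · have := congrArg (fun p => p.coeff k) this
      simp only [fj_coeff Q α w (D + 1) _ _ hD, coeff_zero] at this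
      rwa [Nat.sub_add_cancel hkD] at this
    · intro i hi
      rw [fj_coeff _ _ _ _ _ _ hD, cc_zero _ _ _ _ _ (by omega)]
  · exact cc_zero' _ _ _ _ _ (by omega)

theorem cc_sub' (Q : MvPolynomial (Fin n) ℂ) (α w : Fin n → ℂ) (D m m2 M' : ℕ) (ξ : ℂ)
    (hs : Complex.sinh ξ ≠ 0) (hc : m2 ≠ 0 → Complex.cosh ξ ≠ 0)
    (hD : Q.totalDegree ≤ D + 1) (hQ : QI Q α m m2 ξ) (hw : bil α w = 0)
    (hM : m + m2 = M' + 1) :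
    cc Q α w D M' = - cc Q α w (D + 1) (M' + 1) *
      ((M' + 1) * (M' + 2) / 2 * (Complex.cosh ξ / Complex.sinh ξ) +
      m2 * (m2 + 1) / 2 * (Complex.sinh ξ / Complex.cosh ξ)) := by
  by_cases hkD : M' ≤ D
  · have := one_dim ξ m m2 M' hM hs hc (fj Q α w (D + 1) (D - M')) ?_
      (fun s h => fj_QI Q α w (D + 1) _ m m2 ξ hD hQ hw s h)
    · simp only [fj_coeff Q α w (D + 1) _ _ hD] at this
      rwa [← add_assoc, Nat.sub_add_cancel hkD] at this
    · rw [natDegree_le_iff_coeff_eq_zero]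
      intro i hi
      rw [fj_coeff _ _ _ _ _ _ hD, cc_zero _ _ _ _ _ (by omega)]
  · rw [cc_zero' _ _ _ _ _ (by omega), cc_zero' _ _ _ _ _ (by omega)]; simp

end MultiDim

section Divis
open Polynomial

variable {n : ℕ}

theorem dvd_of_vanish (α : Fin n → ℂ) (hα : bil α α ≠ 0) (T : MvPolynomial (Fin n) ℂ)
    (h : ∀ w, bil α w = 0 → MvPolynomial.eval w T = 0) : linForm α ∣ T := by
  let g : Fin n → MvPolynomial (Fin n) ℂ :=
    fun i => MvPolynomial.X i - MvPolynomial.C (α i / bil α α) * linForm α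
  have h1 : MvPolynomial.aeval g T = 0 := by
    apply MvPolynomial.funext
    intro z
    rw [map_zero, ← h (z - (bil α z / bil α α) • α)]
    · have : ∀ T, MvPolynomial.eval z (MvPolynomial.aeval g T) =
          MvPolynomial.eval (z - (bil α z / bil α α) • α) T := by
        intro T
        induction T using MvPolynomial.induction_on with
        | C a => simp
        | add p q hp hq => simp only [map_add, hp, hq]
        | mul_X p i hp =>
          simp only [map_mul, hp, MvPolynomial.aeval_X, MvPolynomial.eval_X, g, map_sub,
            MvPolynomial.eval_C, linForm_eval, Pi.sub_apply, Pi.smul_apply, smul_eq_mul]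
          ring
      exact this T
    · rw [sub_eq_add_neg, ← neg_smul, bil_add_right, bil_smul_right]
      field_simp
      ring
  have h2 : Ideal.Quotient.mk (Ideal.span {linForm α}) (MvPolynomial.aeval g T) =
      Ideal.Quotient.mk (Ideal.span {linForm α}) T := by
    have : ∀ T, Ideal.Quotient.mk (Ideal.span {linForm α}) (MvPolynomial.aeval g T) =
      Ideal.Quotient.mk (Ideal.span {linForm α}) T := by
      intro T
      induction T using MvPolynomial.induction_on with
      | C a => simp
      | add p q hp hq => simp only [map_add, hp, hq]
      | mul_X p i hp =>
        simp only [map_mul, hp, MvPolynomial.aeval_X, g, map_sub]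
        have : Ideal.Quotient.mk (Ideal.span {linForm α}) (linForm α) = 0 :=
          Ideal.Quotient.eq_zero_iff_mem.2 (Ideal.mem_span_singleton_self _)
        rw [this]; simp
    exact this T
  rw [h1, map_zero] at h2
  exact Ideal.mem_span_singleton.1 (Ideal.Quotient.eq_zero_iff_mem.1 h2.symm)

theorem pow_dvd_of_rho (α : Fin n → ℂ) (hα : bil α α ≠ 0) (M : ℕ) :
    ∀ T : MvPolynomial (Fin n) ℂ,
    (∀ w, bil α w = 0 → ∀ k < M, (rho α w T).coeff k = 0) → linForm α ^ M ∣ T := by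
  induction M with
  | zero => intro T _; simp
  | succ M ih =>
    intro T h
    obtain ⟨T', rfl⟩ := dvd_of_vanish α hα T fun w hw => by
      have := h w hw 0 (by omega)
      rw [coeff_zero_eq_eval_zero, rho_eval] at this
      simpa using this
    rw [pow_succ']
    apply mul_dvd_mul_left
    apply ih
    intro w hw k hk
    have := h w hw (k + 1) (by omega)
    rw [map_mul, rho_linForm, hw, C_0, zero_add, mul_assoc, coeff_C_mul, coeff_X_mul] at this
    exact (mul_eq_zero.1 this).resolve_left hα

theorem linForm_homog (α : Fin n → ℂ) : (linForm α).IsHomogeneous 1 :=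
  MvPolynomial.IsHomogeneous.sum _ _ _ fun _ _ => MvPolynomial.isHomogeneous_C_mul_X _ _

theorem linForm_ne_zero (α : Fin n → ℂ) (hα : bil α α ≠ 0) : linForm α ≠ 0 := by
  intro h; apply hα; rw [← linForm_eval, h]; simp

theorem linForm_irred (α : Fin n → ℂ) (hα : bil α α ≠ 0) : Irreducible (linForm α) := by
  apply MvPolynomial.irreducible_of_totalDegree_eq_one
  · exact (linForm_homog α).totalDegree (linForm_ne_zero α hα)
  · intro x hx
    rw [isUnit_iff_ne_zero]
    rintro rfl
    apply linForm_ne_zero α hα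
    ext i
    simpa using hx i

theorem linForm_coeff (α : Fin n → ℂ) (i : Fin n) :
    MvPolynomial.coeff (Finsupp.single i 1) (linForm α) = α i := by
  simp only [linForm, MvPolynomial.coeff_sum, MvPolynomial.coeff_C_mul]
  rw [Finset.sum_eq_single i]
  · simp
  · intro j _ hj
    rw [MvPolynomial.coeff_X, if_neg]
    · simp
    · intro h
      exact hj (Finsupp.single_left_injective (by norm_num) h)
  · simp

theorem linForm_relPrime (α β : Fin n → ℂ) (hα : bil α α ≠ 0) (hβ : bil β β ≠ 0)
    (h : ∀ c : ℂ, β ≠ c • α) : IsRelPrime (linForm α) (linForm β) := by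
  rw [(linForm_irred α hα).isRelPrime_iff_not_dvd]
  rintro ⟨q, hq⟩
  have hβ0 := linForm_ne_zero β hβ
  have hq0 : q ≠ 0 := by rintro rfl; exact hβ0 (by simpa using hq)
  have hd := congrArg MvPolynomial.totalDegree hq
  rw [MvPolynomial.totalDegree_mul_of_isDomain (linForm_ne_zero α hα) hq0,
    (linForm_homog α).totalDegree (linForm_ne_zero α hα), (linForm_homog β).totalDegree hβ0] at hd
  have : q.totalDegree = 0 := by omega
  rw [MvPolynomial.totalDegree_eq_zero_iff_eq_C] at this
  apply h (q.coeff 0)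
  ext i
  rw [this] at hq
  have := congrArg (MvPolynomial.coeff (Finsupp.single i 1)) hq
  rw [mul_comm, MvPolynomial.coeff_C_mul, linForm_coeff, linForm_coeff] at this
  simpa using this

theorem prod_dvd_of (Rr : Finset (Fin n → ℂ)) (M : (Fin n → ℂ) → ℕ)
    (h0 : ∀ α ∈ Rr, bil α α ≠ 0) (hind : ∀ α ∈ Rr, ∀ β ∈ Rr, α ≠ β → ∀ c : ℂ, β ≠ c • α)
    (T : MvPolynomial (Fin n) ℂ) (h : ∀ α ∈ Rr, linForm α ^ M α ∣ T) :
    ∏ α ∈ Rr, linForm α ^ M α ∣ T := by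
  apply Finset.prod_dvd_of_isRelPrime
  · intro α hα β hβ hne
    exact (linForm_relPrime α β (h0 α hα) (h0 β hβ) (hind α hα β hβ hne)).pow
  · exact h

theorem lowdeg_zero (Rr : Finset (Fin n → ℂ)) (M : (Fin n → ℂ) → ℕ)
    (h0 : ∀ α ∈ Rr, bil α α ≠ 0) (hind : ∀ α ∈ Rr, ∀ β ∈ Rr, α ≠ β → ∀ c : ℂ, β ≠ c • α)
    (T : MvPolynomial (Fin n) ℂ) (h : ∀ α ∈ Rr, linForm α ^ M α ∣ T)
    (hT : T.totalDegree < ∑ α ∈ Rr, M α) : T = 0 := by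
  obtain ⟨q, hq⟩ := prod_dvd_of Rr M h0 hind T h
  by_contra hT0
  have hp : ∏ α ∈ Rr, linForm α ^ M α ≠ 0 := Finset.prod_ne_zero_iff.2 fun α hα =>
    pow_ne_zero _ (linForm_ne_zero α (h0 α hα))
  have hq0 : q ≠ 0 := by rintro rfl; simp at hq; exact hT0 hq
  have hh : (∏ α ∈ Rr, linForm α ^ M α).IsHomogeneous (∑ α ∈ Rr, M α) :=
    MvPolynomial.IsHomogeneous.prod _ _ _ fun α _ => by simpa using (linForm_homog α).pow (M α)
  rw [hq, MvPolynomial.totalDegree_mul_of_isDomain hp hq0, hh.totalDegree hp] at hT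
  omega

theorem top_ne_zero (Q : MvPolynomial (Fin n) ℂ) (hQ : Q ≠ 0) :
    MvPolynomial.homogeneousComponent Q.totalDegree Q ≠ 0 := by
  obtain ⟨μ, hμ, h⟩ := Finset.exists_mem_eq_sup Q.support (MvPolynomial.support_nonempty.2 hQ)
    (fun s => s.sum fun _ e => e)
  intro h0
  have := congrArg (MvPolynomial.coeff μ) h0
  rw [MvPolynomial.coeff_homogeneousComponent, if_pos] at this
  · exact (MvPolynomial.mem_support_iff.1 hμ) (by simpa using this)
  · rw [MvPolynomial.totalDegree, h]; rfl

theorem quasi_zero (Rr : Finset (Fin n → ℂ)) (m m2 : (Fin n → ℂ) → ℕ) (x : Fin n → ℂ)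
    (h0 : ∀ α ∈ Rr, bil α α ≠ 0) (hind : ∀ α ∈ Rr, ∀ β ∈ Rr, α ≠ β → ∀ c : ℂ, β ≠ c • α)
    (hs : ∀ α ∈ Rr, Complex.sinh (bil α x) ≠ 0)
    (hc : ∀ α ∈ Rr, m2 α ≠ 0 → Complex.cosh (bil α x) ≠ 0)
    (Q : MvPolynomial (Fin n) ℂ) (hQ : ∀ α ∈ Rr, QI Q α (m α) (m2 α) (bil α x))
    (hd : Q.totalDegree ≤ ∑ α ∈ Rr, (m α + m2 α))
    (ht : MvPolynomial.homogeneousComponent (∑ α ∈ Rr, (m α + m2 α)) Q = 0) : Q = 0 := by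
  by_contra hne
  have h1 := top_ne_zero Q hne
  have h2 : Q.totalDegree ≠ ∑ α ∈ Rr, (m α + m2 α) := by
    intro h; rw [h] at h1; exact h1 ht
  apply h1
  apply lowdeg_zero Rr (fun α => m α + m2 α) h0 hind
  · intro α hα
    apply pow_dvd_of_rho α (h0 α hα)
    intro w hw k hk
    exact cc_top Q α w Q.totalDegree (m α) (m2 α) _ (hs α hα) (hc α hα) le_rfl (hQ α hα) hw k hk
  · exact lt_of_le_of_lt (MvPolynomial.homogeneousComponent_isHomogeneous _ _).totalDegree_le
      (lt_of_le_of_ne hd h2)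

noncomputable def aa (m m2 : ℕ) (ξ : ℂ) : ℂ :=
  ((m + m2 : ℕ) : ℂ) * ((m + m2 : ℕ) + 1) / 2 * (Complex.cosh ξ / Complex.sinh ξ) +
      m2 * (m2 + 1) / 2 * (Complex.sinh ξ / Complex.cosh ξ)

theorem sub_top (Rr : Finset (Fin n → ℂ)) (m m2 : (Fin n → ℂ) → ℕ) (x : Fin n → ℂ)
    (h0 : ∀ α ∈ Rr, bil α α ≠ 0) (hind : ∀ α ∈ Rr, ∀ β ∈ Rr, α ≠ β → ∀ c : ℂ, β ≠ c • α)
    (hm : ∀ α ∈ Rr, 1 ≤ m α)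
    (hs : ∀ α ∈ Rr, Complex.sinh (bil α x) ≠ 0)
    (hc : ∀ α ∈ Rr, m2 α ≠ 0 → Complex.cosh (bil α x) ≠ 0)
    (Q : MvPolynomial (Fin n) ℂ) (hQ : ∀ α ∈ Rr, QI Q α (m α) (m2 α) (bil α x))
    (N' : ℕ) (hN : ∑ α ∈ Rr, (m α + m2 α) = N' + 1) (hd : Q.totalDegree ≤ N' + 1)
    (B : (Fin n → ℂ) → MvPolynomial (Fin n) ℂ)
    (hB : ∀ α ∈ Rr, linForm α * B α = MvPolynomial.homogeneousComponent (N' + 1) Q) :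
    MvPolynomial.homogeneousComponent N' Q =
      - ∑ α ∈ Rr, MvPolynomial.C (bil α α * aa (m α) (m2 α) (bil α x)) * B α := by
  classical
  rw [eq_neg_iff_add_eq_zero]
  have hBd : ∀ α ∈ Rr, (B α).totalDegree ≤ N' := by
    intro α hα
    by_cases hB0 : B α = 0
    · simp [hB0]
    · have h1 := congrArg MvPolynomial.totalDegree (hB α hα)
      have h2 := (MvPolynomial.homogeneousComponent_isHomogeneous (N' + 1) Q).totalDegree_le
      rw [MvPolynomial.totalDegree_mul_of_isDomain (linForm_ne_zero α (h0 α hα)) hB0,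
        (linForm_homog α).totalDegree (linForm_ne_zero α (h0 α hα))] at h1
      omega
  have htop : ∀ α ∈ Rr, linForm α ^ (m α + m2 α) ∣
      MvPolynomial.homogeneousComponent (N' + 1) Q := by
    intro α hα
    apply pow_dvd_of_rho α (h0 α hα)
    intro w hw k hk
    exact cc_top Q α w _ (m α) (m2 α) _ (hs α hα) (hc α hα) hd (hQ α hα) hw k hk
  apply lowdeg_zero Rr (fun α => m α + m2 α) h0 hind
  · intro α hα
    rw [← Finset.add_sum_erase _ _ hα, ← add_assoc]
    apply dvd_add
    · apply pow_dvd_of_rho α (h0 α hα)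
      intro w hw k hk
      have e1 : bil α α * (rho α w (B α)).coeff k = cc Q α w (N' + 1) (k + 1) := by
        rw [cc, ← hB α hα, map_mul, rho_linForm, hw, C_0, zero_add, mul_assoc, coeff_C_mul,
          coeff_X_mul]
      have e2 : (rho α w (MvPolynomial.homogeneousComponent N' Q +
          MvPolynomial.C (bil α α * aa (m α) (m2 α) (bil α x)) * B α)).coeff k =
          cc Q α w N' k + aa (m α) (m2 α) (bil α x) * cc Q α w (N' + 1) (k + 1) := by
        rw [← e1, map_add, map_mul, coeff_add, cc]
        have : rho α w (MvPolynomial.C (bil α α * aa (m α) (m2 α) (bil α x))) =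
          C (bil α α * aa (m α) (m2 α) (bil α x)) := by simp [rho]
        rw [this, coeff_C_mul]
        ring
      rw [e2]
      by_cases hk1 : k + 1 < m α + m2 α
      · rw [cc_sub Q α w N' (m α) (m2 α) _ (hs α hα) (hc α hα) hd (hQ α hα) hw k hk1,
          cc_top Q α w _ (m α) (m2 α) _ (hs α hα) (hc α hα) hd (hQ α hα) hw _ hk1]
        simp
      · have hM : m α + m2 α = k + 1 := by omega
        rw [cc_sub' Q α w N' (m α) (m2 α) k _ (hs α hα) (hc α hα) hd (hQ α hα) hw hM, aa, hM]
        push_cast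
        ring
    · apply Finset.dvd_sum
      intro β hβ
      apply Dvd.dvd.mul_left
      rw [Finset.mem_erase] at hβ
      have := htop α hα
      rw [← hB β hβ.2] at this
      exact IsRelPrime.dvd_of_dvd_mul_left (IsRelPrime.pow_left
        (linForm_relPrime α β (h0 α hα) (h0 β hβ.2) (hind α hα β hβ.2 hβ.1.symm))) this
  · rw [hN]
    apply Nat.lt_succ_of_le
    refine (MvPolynomial.totalDegree_add _ _).trans (max_le ?_ ?_)
    · exact (MvPolynomial.homogeneousComponent_isHomogeneous _ _).totalDegree_le
    · apply MvPolynomial.totalDegree_finsetSum_le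
      intro α hα
      refine (MvPolynomial.totalDegree_mul _ _).trans ?_
      rw [MvPolynomial.totalDegree_C, zero_add]
      exact hBd α hα

end Divis

section Analytic
open Filter Topology

variable {n : ℕ}

theorem coef_analytic (p : ℂ → MvPolynomial (Fin n) ℂ) (N : ℕ)
    (hd : ∀ᶠ t in 𝓝 (0 : ℂ), (p t).totalDegree ≤ N)
    (hz : ∀ z, AnalyticAt ℂ (fun t => MvPolynomial.eval z (p t)) 0) (μ : Fin n →₀ ℕ) :
    AnalyticAt ℂ (fun t => MvPolynomial.coeff μ (p t)) 0 := by
  classical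
  let s : Finset (Fin n →₀ ℕ) := (Finsupp.finite_of_degree_le (σ := Fin n) N).toFinset
  have hs : ∀ q : MvPolynomial (Fin n) ℂ, q.totalDegree ≤ N → ∀ ν, ν ∉ s → q.coeff ν = 0 := by
    intro q hq ν hν
    apply MvPolynomial.coeff_eq_zero_of_totalDegree_lt
    simp only [s, Set.Finite.mem_toFinset, Set.mem_ofPred_eq, not_le, Finsupp.degree_apply] at hν
    omega
  by_cases hμ : μ ∈ s
  swap
  · refine AnalyticAt.congr (f := fun _ => 0) analyticAt_const ?_
    filter_upwards [hd] with t ht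
    exact (hs _ ht μ hμ).symm
  let E : (Fin n → ℂ) → Module.Dual ℂ (s → ℂ) := fun z =>
    ∑ ν : s, (∏ i, z i ^ (ν : Fin n →₀ ℕ) i) • LinearMap.proj ν
  have hE : ∀ z (v : s → ℂ), E z v = ∑ ν : s, (∏ i, z i ^ (ν : Fin n →₀ ℕ) i) * v ν := by
    intro z v; simp [E]
  have hspan : Submodule.span ℂ (Set.range E) = ⊤ := by
    rw [← Subspace.dualCoannihilator_dualAnnihilator_eq (W := Submodule.span ℂ (Set.range E))]
    have : (Submodule.span ℂ (Set.range E)).dualCoannihilator = ⊥ := by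
      rw [eq_bot_iff]
      intro v hv
      rw [Submodule.mem_dualCoannihilator] at hv
      have hv' : ∀ z, E z v = 0 := fun z => hv _ (Submodule.subset_span ⟨z, rfl⟩)
      let q : MvPolynomial (Fin n) ℂ := ∑ ν : s, MvPolynomial.monomial (ν : Fin n →₀ ℕ) (v ν)
      have hq : q = 0 := by
        apply MvPolynomial.funext
        intro z
        rw [map_zero, ← hv' z, hE, map_sum]
        refine Finset.sum_congr rfl fun ν _ => ?_
        rw [MvPolynomial.eval_monomial, Finsupp.prod_fintype _ _ (by simp), mul_comm]
      rw [Submodule.mem_bot]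
      ext ν
      have := congrArg (MvPolynomial.coeff (ν : Fin n →₀ ℕ)) hq
      simp only [q, MvPolynomial.coeff_sum, MvPolynomial.coeff_monomial] at this
      rw [Finset.sum_eq_single ν] at this
      · simpa using this
      · intro b _ hb
        rw [if_neg]
        exact fun h => hb (Subtype.ext h)
      · simp
    rw [this]; simp
  have hall : ∀ φ ∈ Submodule.span ℂ (Set.range E),
      AnalyticAt ℂ (fun t => φ (fun ν : s => MvPolynomial.coeff (ν : Fin n →₀ ℕ) (p t))) 0 := by
    intro φ hφ
    induction hφ using Submodule.span_induction with
    | mem φ h =>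
      obtain ⟨z, rfl⟩ := h
      refine (hz z).congr ?_
      filter_upwards [hd] with t ht
      rw [hE, MvPolynomial.eval_eq']
      rw [Finset.sum_coe_sort s (fun ν => (∏ i, z i ^ ν i) * MvPolynomial.coeff ν (p t))]
      apply Finset.sum_subset_zero_on_sdiff
      · intro ν hν
        by_contra hns
        exact (MvPolynomial.mem_support_iff.1 hν) (hs _ ht ν hns)
      · intro ν hν
        rw [Finset.mem_sdiff, MvPolynomial.notMem_support_iff] at hν
        rw [hν.2, mul_zero]
      · intro ν _; ring
    | zero => simpa using analyticAt_const
    | add a b _ _ ha hb => simpa using ha.fun_add hb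
    | smul c a _ ha => simpa using (analyticAt_const (v := c)).fun_mul ha
  have := hall (LinearMap.proj ⟨μ, hμ⟩) (by rw [hspan]; trivial)
  simpa using this

theorem line_lemma (p : ℂ → MvPolynomial (Fin n) ℂ) (N : ℕ)
    (hd : ∀ᶠ t in 𝓝 (0 : ℂ), (p t).totalDegree ≤ N)
    (hz : ∀ z, AnalyticAt ℂ (fun t => MvPolynomial.eval z (p t)) 0) :
    ∃ P1 P2 : MvPolynomial (Fin n) ℂ,
      (∀ μ, P1.coeff μ = deriv (fun t => MvPolynomial.coeff μ (p t)) 0) ∧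
      (∀ μ, P2.coeff μ = iteratedDeriv 2 (fun t => MvPolynomial.coeff μ (p t)) 0) ∧
      (∀ z, deriv (fun t => MvPolynomial.eval z (p t)) 0 = MvPolynomial.eval z P1) ∧
      (∀ z, iteratedDeriv 2 (fun t => MvPolynomial.eval z (p t)) 0 = MvPolynomial.eval z P2) := by
  classical
  have hc := coef_analytic p N hd hz
  let s : Finset (Fin n →₀ ℕ) := (Finsupp.finite_of_degree_le (σ := Fin n) N).toFinset
  have hs : ∀ q : MvPolynomial (Fin n) ℂ, q.totalDegree ≤ N → ∀ ν, ν ∉ s → q.coeff ν = 0 := by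
    intro q hq ν hν
    apply MvPolynomial.coeff_eq_zero_of_totalDegree_lt
    simp only [s, Set.Finite.mem_toFinset, Set.mem_ofPred_eq, not_le, Finsupp.degree_apply] at hν
    omega
  have hev : ∀ z, (fun t => MvPolynomial.eval z (p t)) =ᶠ[𝓝 0]
      fun t => ∑ ν ∈ s, MvPolynomial.coeff ν (p t) * ∏ i, z i ^ ν i := by
    intro z
    filter_upwards [hd] with t ht
    rw [MvPolynomial.eval_eq']
    apply Finset.sum_subset
    · intro ν hν
      by_contra hns
      exact (MvPolynomial.mem_support_iff.1 hν) (hs _ ht ν hns)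
    · intro ν _ hν
      rw [MvPolynomial.notMem_support_iff] at hν
      rw [hν, zero_mul]
  have hcoef : ∀ (d : (Fin n →₀ ℕ) → ℂ), (∀ μ, μ ∉ s → d μ = 0) → ∀ μ,
      (∑ ν ∈ s, MvPolynomial.monomial ν (d ν)).coeff μ = d μ := by
    intro d hd μ
    simp only [MvPolynomial.coeff_sum, MvPolynomial.coeff_monomial, Finset.sum_ite_eq']
    split_ifs with h
    · rfl
    · exact (hd μ h).symm
  have hout : ∀ μ, μ ∉ s → (fun t => MvPolynomial.coeff μ (p t)) =ᶠ[𝓝 0] fun _ => 0 := by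
    intro μ hμ
    filter_upwards [hd] with t ht
    exact hs _ ht μ hμ
  refine ⟨∑ ν ∈ s, MvPolynomial.monomial ν (deriv (fun t => MvPolynomial.coeff ν (p t)) 0),
    ∑ ν ∈ s, MvPolynomial.monomial ν (iteratedDeriv 2 (fun t => MvPolynomial.coeff ν (p t)) 0),
    hcoef (fun μ => deriv (fun t => MvPolynomial.coeff μ (p t)) 0) ?_,
    hcoef (fun μ => iteratedDeriv 2 (fun t => MvPolynomial.coeff μ (p t)) 0) ?_, ?_, ?_⟩
  · intro μ hμ
    rw [(hout μ hμ).deriv_eq]; simp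
  · intro μ hμ
    rw [(hout μ hμ).iteratedDeriv_eq]; simp
  · intro z
    rw [(hev z).deriv_eq, deriv_fun_sum fun ν _ => ((hc ν).differentiableAt.mul_const _), map_sum]
    refine Finset.sum_congr rfl fun ν _ => ?_
    rw [MvPolynomial.eval_monomial, Finsupp.prod_fintype _ _ (by simp),
      deriv_mul_const (hc ν).differentiableAt]
  · intro z
    rw [(hev z).iteratedDeriv_eq, iteratedDeriv_fun_sum fun ν _ =>
      ((hc ν).fun_mul analyticAt_const).contDiffAt, map_sum]
    refine Finset.sum_congr rfl fun ν _ => ?_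
    rw [MvPolynomial.eval_monomial, Finsupp.prod_fintype _ _ (by simp)]
    simp only [mul_comm _ (∏ i, z i ^ ν i)]
    rw [iteratedDeriv_const_mul_field]

theorem deriv2_mul_exp (g : ℂ → ℂ) (hg : AnalyticAt ℂ g 0) (a b : ℂ) :
    iteratedDeriv 2 (fun t => g t * Complex.exp (b + t * a)) 0 =
      (iteratedDeriv 2 g 0 + 2 * a * deriv g 0 + a ^ 2 * g 0) * Complex.exp b := by
  have hE : ∀ t, HasDerivAt (fun t => Complex.exp (b + t * a)) (Complex.exp (b + t * a) * a) t := by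
    intro t
    have := ((hasDerivAt_id t).mul_const a).const_add b
    simpa using this.cexp
  have h1 : deriv (fun t => g t * Complex.exp (b + t * a)) =ᶠ[𝓝 0]
      fun t => (deriv g t + a * g t) * Complex.exp (b + t * a) := by
    filter_upwards [hg.eventually_analyticAt] with t ht
    rw [(ht.differentiableAt.hasDerivAt.fun_mul (hE t)).deriv]
    ring
  rw [iteratedDeriv_succ, iteratedDeriv_one, h1.deriv_eq]
  have h2 := hg.deriv.differentiableAt.hasDerivAt.fun_add
    (hg.differentiableAt.hasDerivAt.const_mul a)
  rw [(h2.fun_mul (hE 0)).deriv, iteratedDeriv_succ, iteratedDeriv_one]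
  simp
  ring

noncomputable def da (m m2 : ℕ) (ξ : ℂ) : ℂ :=
  - (((m + m2 : ℕ) : ℂ) * ((m + m2 : ℕ) + 1) / 2 / Complex.sinh ξ ^ 2) +
      m2 * (m2 + 1) / 2 / Complex.cosh ξ ^ 2

theorem aa_deriv (m m2 : ℕ) (ξ : ℂ) (hs : Complex.sinh ξ ≠ 0)
    (hc : m2 ≠ 0 → Complex.cosh ξ ≠ 0) : HasDerivAt (aa m m2) (da m m2 ξ) ξ := by
  have h1 : HasDerivAt (fun ξ => Complex.cosh ξ / Complex.sinh ξ) (- (1 / Complex.sinh ξ ^ 2)) ξ := by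
    refine ((Complex.hasDerivAt_cosh ξ).fun_div (Complex.hasDerivAt_sinh ξ) hs).congr_deriv ?_
    field_simp
    linear_combination -Complex.cosh_sq_sub_sinh_sq ξ
  have h1' := h1.const_mul (((m + m2 : ℕ) : ℂ) * ((m + m2 : ℕ) + 1) / 2)
  by_cases h2 : m2 = 0
  · subst h2
    have e : aa m 0 = fun ξ => ((m + 0 : ℕ) : ℂ) * ((m + 0 : ℕ) + 1) / 2 *
      (Complex.cosh ξ / Complex.sinh ξ) := by
      ext ξ; simp [aa]
    rw [e]
    refine h1'.congr_deriv ?_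
    simp [da]
    ring
  · have hc' := hc h2
    have h3 : HasDerivAt (fun ξ => Complex.sinh ξ / Complex.cosh ξ) (1 / Complex.cosh ξ ^ 2) ξ := by
      refine ((Complex.hasDerivAt_sinh ξ).fun_div (Complex.hasDerivAt_cosh ξ) hc').congr_deriv ?_
      field_simp
      linear_combination Complex.cosh_sq_sub_sinh_sq ξ
    have := h1'.fun_add (h3.const_mul ((m2 : ℂ) * (m2 + 1) / 2))
    refine HasDerivAt.congr_deriv (f := aa m m2) this ?_
    simp only [da]
    ring

theorem sum_split {A : Type*} [AddCommMonoid A] (R : Finset (Fin n → ℂ))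
    [DecidablePred fun α : Fin n → ℂ => (2⁻¹ : ℂ) • α ∉ R]
    [DecidablePred fun α : Fin n → ℂ => (2 : ℂ) • α ∈ R]
    (h4 : ∀ α ∈ R, (2 : ℂ) • α ∈ R → (2⁻¹ : ℂ) • α ∉ R) (F : (Fin n → ℂ) → A) :
    ∑ γ ∈ R, F γ = ∑ α ∈ R.filter (fun α => (2⁻¹ : ℂ) • α ∉ R),
      (F α + if (2 : ℂ) • α ∈ R then F ((2 : ℂ) • α) else 0) := by
  rw [Finset.sum_add_distrib, ← Finset.sum_filter_add_sum_filter_not R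
    (fun α => (2⁻¹ : ℂ) • α ∉ R), ← Finset.sum_filter]
  congr 1
  apply Finset.sum_nbij' (fun α => (2⁻¹ : ℂ) • α) (fun α => (2 : ℂ) • α)
  · intro α hα
    simp only [Finset.mem_filter, not_not] at hα ⊢
    have e : (2 : ℂ) • (2⁻¹ : ℂ) • α = α := by rw [smul_smul]; norm_num
    refine ⟨⟨hα.2, ?_⟩, by rw [e]; exact hα.1⟩
    exact h4 _ hα.2 (by rw [e]; exact hα.1)
  · intro α hα
    simp only [Finset.mem_filter, not_not] at hα ⊢
    have e : (2⁻¹ : ℂ) • (2 : ℂ) • α = α := by rw [smul_smul]; norm_num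
    exact ⟨hα.2, by rw [e]; exact hα.1.1⟩
  · intro α _
    rw [smul_smul]; norm_num
  · intro α _
    rw [smul_smul]; norm_num
  · intro α _
    rw [smul_smul]; norm_num

end Analytic

section Core
open MvPolynomial

variable {n : ℕ}

theorem B_degree (α : Fin n → ℂ) (hα : bil α α ≠ 0) (B T : MvPolynomial (Fin n) ℂ) (N' : ℕ)
    (hT : T.totalDegree ≤ N' + 1) (hB : linForm α * B = T) : B.totalDegree ≤ N' := by
  by_cases hB0 : B = 0
  · simp [hB0]
  · have h1 := congrArg MvPolynomial.totalDegree hB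
    rw [MvPolynomial.totalDegree_mul_of_isDomain (linForm_ne_zero α hα) hB0,
      (linForm_homog α).totalDegree (linForm_ne_zero α hα)] at h1
    omega

theorem coeff_big (Q : MvPolynomial (Fin n) ℂ) (N : ℕ) (hQ : Q.totalDegree ≤ N)
    (μ : Fin n →₀ ℕ) (hμ : N < μ.degree) : coeff μ Q = 0 := by
  apply MvPolynomial.coeff_eq_zero_of_totalDegree_lt
  rw [Finsupp.degree_apply] at hμ
  omega

theorem deg_of_coeff (Q : MvPolynomial (Fin n) ℂ) (N : ℕ)
    (h : ∀ μ : Fin n →₀ ℕ, N ≤ μ.degree → coeff μ Q = 0) :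
    Q.totalDegree ≤ N ∧ homogeneousComponent N Q = 0 := by
  constructor
  · rw [MvPolynomial.totalDegree]
    apply Finset.sup_le
    intro μ hμ
    by_contra hlt
    exact (MvPolynomial.mem_support_iff.1 hμ) (h μ (by
      rw [Finsupp.degree_apply]; exact (not_le.1 hlt).le))
  · ext μ
    rw [coeff_homogeneousComponent]
    split_ifs with hμ
    · rw [h μ hμ.ge]; simp
    · simp

theorem coeff_X_mul_zero (D : MvPolynomial (Fin n) ℂ) (N' : ℕ) (i : Fin n)
    (h : ∀ μ : Fin n →₀ ℕ, N' ≤ μ.degree → coeff μ D = 0) (μ : Fin n →₀ ℕ)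
    (hμ : N' + 1 ≤ μ.degree) : coeff μ (X i * D) = 0 := by
  classical
  rw [coeff_X_mul']
  split_ifs with hi
  · apply h
    have h1 : Finsupp.single i 1 ≤ μ := by
      rw [Finsupp.single_le_iff]
      exact Nat.one_le_iff_ne_zero.2 (Finsupp.mem_support_iff.1 hi)
    have h2 := congrArg Finsupp.degree (tsub_add_cancel_of_le h1)
    rw [map_add, Finsupp.degree_single] at h2
    omega
  · rfl

theorem core_deg (Rr : Finset (Fin n → ℂ)) (N' : ℕ) (B : (Fin n → ℂ) → MvPolynomial (Fin n) ℂ)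
    (P1 P2 : Fin n → MvPolynomial (Fin n) ℂ) (Px PN : MvPolynomial (Fin n) ℂ)
    (d : (Fin n → ℂ) → ℂ) (hB : ∀ α ∈ Rr, linForm α * B α = PN)
    (hBd : ∀ α ∈ Rr, (B α).totalDegree ≤ N')
    (h2 : ∀ i, ∀ μ : Fin n →₀ ℕ, N' + 1 ≤ μ.degree → coeff μ (P2 i) = 0)
    (h1 : ∀ i, ∀ μ : Fin n →₀ ℕ, N' + 1 ≤ μ.degree → coeff μ (P1 i) = 0)
    (h1' : ∀ i, ∀ μ : Fin n →₀ ℕ, μ.degree = N' →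
      coeff μ (P1 i) = - ∑ α ∈ Rr, (d α * α i) * coeff μ (B α))
    (hP : ∀ μ : Fin n →₀ ℕ, N' + 1 ≤ μ.degree → coeff μ Px = coeff μ PN)
    (μ : Fin n →₀ ℕ) (hμ : N' + 1 ≤ μ.degree) :
    coeff μ (∑ i, (P2 i + C 2 * (X i * P1 i)) - C (-2 * ∑ α ∈ Rr, d α) * Px) = 0 := by
  have hD : ∀ i, coeff μ (X i * (P1 i + ∑ α ∈ Rr, C (d α * α i) * B α)) = 0 := by
    intro i
    apply coeff_X_mul_zero _ N' i _ _ hμ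
    intro ν hν
    rw [coeff_add, coeff_sum]
    simp only [coeff_C_mul]
    rcases hν.eq_or_lt with h | h
    · rw [h1' i ν h.symm]; ring
    · rw [h1 i ν h, zero_add]
      apply Finset.sum_eq_zero
      intro α hα
      rw [coeff_big _ _ (hBd α hα) ν h, mul_zero]
  have key : ∑ i, (P2 i + C 2 * (X i * P1 i)) - C (-2 * ∑ α ∈ Rr, d α) * Px =
      ∑ i, P2 i + C 2 * ∑ i, X i * (P1 i + ∑ α ∈ Rr, C (d α * α i) * B α) -
        C (-2 * ∑ α ∈ Rr, d α) * (Px - PN) := by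
    have e1 : ∑ i, X i * (P1 i + ∑ α ∈ Rr, C (d α * α i) * B α) =
        ∑ i, X i * P1 i + C (∑ α ∈ Rr, d α) * PN := by
      simp only [mul_add, Finset.sum_add_distrib]
      congr 1
      simp only [Finset.mul_sum]
      rw [Finset.sum_comm, map_sum, Finset.sum_mul]
      refine Finset.sum_congr rfl fun α hα => ?_
      rw [← hB α hα, linForm, Finset.sum_mul, Finset.mul_sum]
      refine Finset.sum_congr rfl fun i _ => ?_
      rw [C_mul]
      ring
    rw [e1, Finset.sum_add_distrib, ← Finset.mul_sum, C_mul, C_neg]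
    ring
  rw [key, coeff_sub, coeff_add, coeff_sum, coeff_C_mul, coeff_C_mul, coeff_sub, coeff_sum,
    hP μ hμ, Finset.sum_eq_zero fun i _ => hD i, Finset.sum_eq_zero fun i _ => h2 i μ hμ]
  ring

theorem u_term (m m2 : ℕ) (b ξ : ℂ) (hs : Complex.sinh ξ ≠ 0)
    (hc : m2 ≠ 0 → Complex.cosh ξ ≠ 0) :
    (m : ℂ) * ((m : ℂ) + 2 * (m2 : ℂ) + 1) * b / Complex.sinh ξ ^ 2 +
      (m2 : ℂ) * (m2 + 1) * (4 * b) / Complex.sinh (2 * ξ) ^ 2 = -2 * (b * da m m2 ξ) := by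
  by_cases h2 : m2 = 0
  · subst h2
    simp [da]
    ring
  · have hc' := hc h2
    rw [da, Complex.sinh_two_mul]
    have h := Complex.cosh_sq_sub_sinh_sq ξ
    field_simp
    push_cast
    linear_combination (-4 * b * (m2 : ℂ) * (m2 + 1)) * h

end Core

section Line
open MvPolynomial Filter Topology

variable {n : ℕ}

theorem bil_sub_left (a b c : Fin n → ℂ) : bil (a - b) c = bil a c - bil b c := by
  simp [bil, sub_mul, Finset.sum_sub_distrib]

theorem bil_single (z : Fin n → ℂ) (i : Fin n) : bil z (Pi.single i 1) = z i := by
  simp [bil, Pi.single_apply]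

theorem QI_of (Q : MvPolynomial (Fin n) ℂ) (α x : Fin n → ℂ) (m m2 : ℕ)
    (h : ∀ s : ℕ, SS m m2 s → ∀ w, bil α w = 0 →
      eval (w + (s : ℂ) • α) Q * Complex.exp (bil (w + (s : ℂ) • α) x) =
      eval (w - (s : ℂ) • α) Q * Complex.exp (bil (w - (s : ℂ) • α) x)) :
    QI Q α m m2 (bil α x) := by
  intro s hs w hw
  have := h s hs w hw
  rw [bil_add_left, bil_sub_left, bil_smul_left, Complex.exp_add, sub_eq_add_neg (bil w x),
    Complex.exp_add] at this
  apply mul_left_cancel₀ (Complex.exp_ne_zero (bil w x))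
  rw [neg_mul]
  linear_combination this

theorem U_open (R : Finset (Fin n → ℂ)) :
    IsOpen {x : Fin n → ℂ | ∀ γ ∈ R, Complex.sinh (bil γ x) ≠ 0} := by
  have : {x : Fin n → ℂ | ∀ γ ∈ R, Complex.sinh (bil γ x) ≠ 0} =
      ⋂ γ ∈ R, {x | Complex.sinh (bil γ x) ≠ 0} := by
    ext x; simp
  rw [this]
  apply isOpen_biInter_finset
  intro γ _
  have hc : Continuous fun x : Fin n → ℂ => Complex.sinh (bil γ x) := by
    apply Complex.continuous_sinh.comp
    unfold bil
    fun_prop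
  exact isOpen_ne_fun hc continuous_const

theorem line_mem (U : Set (Fin n → ℂ)) (hU : IsOpen U) (x : Fin n → ℂ) (hx : x ∈ U) (i : Fin n) :
    ∀ᶠ t in 𝓝 (0 : ℂ), x + t • (Pi.single i 1 : Fin n → ℂ) ∈ U := by
  have hc : Continuous fun t : ℂ => x + t • (Pi.single i 1 : Fin n → ℂ) := by fun_prop
  exact hc.continuousAt.eventually_mem (hU.mem_nhds (by simpa using hx))

theorem line_data (U : Set (Fin n → ℂ)) (hU : IsOpen U)
    (ψ : (Fin n → ℂ) → (Fin n → ℂ) → ℂ) (P : (Fin n → ℂ) → MvPolynomial (Fin n) ℂ) (N : ℕ)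
    (hform : ∀ x ∈ U, ∀ z, ψ z x = MvPolynomial.eval z (P x) * Complex.exp (bil z x))
    (hdeg : ∀ x ∈ U, (P x).totalDegree = N)
    (hanal : ∀ z, AnalyticOnNhd ℂ (fun x => ψ z x) U) (x : Fin n → ℂ) (hx : x ∈ U) (i : Fin n) :
    ∃ P1 P2 : MvPolynomial (Fin n) ℂ,
      (∀ μ, P1.coeff μ =
        deriv (fun t : ℂ => coeff μ (P (x + t • (Pi.single i 1 : Fin n → ℂ)))) 0) ∧
      (∀ μ, P2.coeff μ =
        iteratedDeriv 2 (fun t : ℂ => coeff μ (P (x + t • (Pi.single i 1 : Fin n → ℂ)))) 0) ∧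
      (∀ z, iteratedDeriv 2 (fun t : ℂ => ψ z (x + t • (Pi.single i 1 : Fin n → ℂ))) 0 =
        (eval z P2 + 2 * z i * eval z P1 + z i ^ 2 * eval z (P x)) * Complex.exp (bil z x)) := by
  have hmem := line_mem U hU x hx i
  have hbil : ∀ z (t : ℂ), bil z (x + t • (Pi.single i 1 : Fin n → ℂ)) = bil z x + t * z i := by
    intro z t
    rw [bil_add_right, bil_smul_right, bil_single]
  have hψ : ∀ z, AnalyticAt ℂ (fun t : ℂ => ψ z (x + t • (Pi.single i 1 : Fin n → ℂ))) 0 := by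
    intro z
    have h1 : AnalyticAt ℂ (fun t : ℂ => x + t • (Pi.single i 1 : Fin n → ℂ)) 0 := by fun_prop
    exact AnalyticAt.fun_comp_of_eq (hanal z x hx) h1 (by simp)
  have hz : ∀ z, AnalyticAt ℂ
      (fun t : ℂ => eval z (P (x + t • (Pi.single i 1 : Fin n → ℂ)))) 0 := by
    intro z
    have h2 : AnalyticAt ℂ (fun t : ℂ => Complex.exp (-(bil z x + t * z i))) 0 := by fun_prop
    refine ((hψ z).fun_mul h2).congr ?_
    filter_upwards [hmem] with t ht
    rw [hform _ ht, hbil, mul_assoc, ← Complex.exp_add]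
    simp
  obtain ⟨P1, P2, h1, h2, h3, h4⟩ := line_lemma
    (fun t : ℂ => P (x + t • (Pi.single i 1 : Fin n → ℂ))) N
    (by filter_upwards [hmem] with t ht; exact (hdeg _ ht).le) hz
  refine ⟨P1, P2, h1, h2, fun z => ?_⟩
  have he : (fun t : ℂ => ψ z (x + t • (Pi.single i 1 : Fin n → ℂ))) =ᶠ[𝓝 0]
      fun t => eval z (P (x + t • (Pi.single i 1 : Fin n → ℂ))) *
        Complex.exp (bil z x + t * z i) := by
    filter_upwards [hmem] with t ht
    rw [hform _ ht, hbil]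
  rw [he.iteratedDeriv_eq, deriv2_mul_exp _ (hz z), h3, h4]
  simp

end Line

/-- A Baker–Akhiezer function is an eigenfunction of the
generalised Calogero–Moser–Sutherland operator, with eigenvalue `⟨z,z⟩`. -/
theorem stmt_6 (n : ℕ) (hn : 1 ≤ n)
    (R : Finset (Fin n → ℂ))
    (hR0 : ∀ γ ∈ R, bil γ γ ≠ 0)
    (hRcol : ∀ γ ∈ R, ∀ δ ∈ R, γ ≠ δ → (∃ c : ℂ, δ = c • γ) →
      δ = (2 : ℂ) • γ ∨ γ = (2 : ℂ) • δ)
    (mult mult2 : (Fin n → ℂ) → ℕ)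
    (hmult : ∀ α ∈ R, (2⁻¹ : ℂ) • α ∉ R → 1 ≤ mult α)
    (hmult2 : ∀ α : Fin n → ℂ,
      ((2 : ℂ) • α ∈ R → mult2 α = mult ((2 : ℂ) • α)) ∧
      ((2 : ℂ) • α ∉ R → mult2 α = 0))
    (N : ℕ) (hN : N = ∑ γ ∈ R, mult γ)
    (U : Set (Fin n → ℂ))
    (hU : U = {x : Fin n → ℂ | ∀ γ ∈ R, Complex.sinh (bil γ x) ≠ 0})
    (ψ : (Fin n → ℂ) → (Fin n → ℂ) → ℂ)
    (P : (Fin n → ℂ) → MvPolynomial (Fin n) ℂ)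
    (hform : ∀ x ∈ U, ∀ z, ψ z x = MvPolynomial.eval z (P x) * Complex.exp (bil z x))
    (hdeg : ∀ x ∈ U, (P x).totalDegree = N)
    (hhc : ∀ x ∈ U,
      MvPolynomial.homogeneousComponent N (P x) = ∏ γ ∈ R, linForm γ ^ mult γ)
    (hquasi : ∀ x ∈ U, QuasiInv R mult mult2 (fun z => ψ z x))
    (hanal : ∀ z, AnalyticOnNhd ℂ (fun x => ψ z x) U) :
    ∀ x ∈ U, ∀ z : Fin n → ℂ,
      (∑ i : Fin n,
          iteratedDeriv 2 (fun t : ℂ => ψ z (x + t • (Pi.single i 1 : Fin n → ℂ))) 0)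
        - (∑ γ ∈ R,
            (mult γ : ℂ) * ((mult γ : ℂ) + 2 * (mult2 γ : ℂ) + 1) * bil γ γ
              / (Complex.sinh (bil γ x)) ^ 2) * ψ z x
        = bil z z * ψ z x := by
  classical
  intro x hx
  have hUo : IsOpen U := hU ▸ U_open R
  have hUs : ∀ y ∈ U, ∀ γ ∈ R, Complex.sinh (bil γ y) ≠ 0 := by
    intro y hy
    rw [hU] at hy
    exact hy
  have hne : ∀ γ ∈ R, γ ≠ 0 := by
    rintro γ hγ rfl
    exact hR0 _ hγ (by simp [bil])

  have h4 : ∀ α ∈ R, (2 : ℂ) • α ∈ R → (2⁻¹ : ℂ) • α ∉ R := by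
    intro α hα h2 hh
    have key : ∀ c : ℂ, c • α = 0 → c = 0 := fun c hc =>
      (smul_eq_zero.1 hc).resolve_right (hne α hα)
    have hd : (2⁻¹ : ℂ) • α ≠ (2 : ℂ) • α := by
      intro h
      have := key (2⁻¹ - 2) (by rw [sub_smul, h, sub_self])
      norm_num at this
    rcases hRcol _ hh _ h2 hd ⟨4, by rw [smul_smul]; norm_num⟩ with h | h
    · have := key (2 - 2 * 2⁻¹) (by rw [sub_smul, mul_smul, ← h, sub_self])
      norm_num at this
    · have := key (2⁻¹ - 2 * 2) (by rw [sub_smul, mul_smul, ← h, sub_self])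
      norm_num at this
  let Rr : Finset (Fin n → ℂ) := R.filter (fun α => (2⁻¹ : ℂ) • α ∉ R)
  have hRr : ∀ α ∈ Rr, α ∈ R ∧ (2⁻¹ : ℂ) • α ∉ R := fun α hα => Finset.mem_filter.1 hα
  have h0 : ∀ α ∈ Rr, bil α α ≠ 0 := fun α hα => hR0 α (hRr α hα).1
  have hhalf : ∀ α : Fin n → ℂ, (2⁻¹ : ℂ) • (2 : ℂ) • α = α := by
    intro α; rw [smul_smul]; norm_num
  have hind : ∀ α ∈ Rr, ∀ β ∈ Rr, α ≠ β → ∀ c : ℂ, β ≠ c • α := by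
    intro α hα β hβ hne' c hc
    rcases hRcol α (hRr α hα).1 β (hRr β hβ).1 hne' ⟨c, hc⟩ with h | h
    · exact (hRr β hβ).2 (by rw [h, hhalf]; exact (hRr α hα).1)
    · exact (hRr α hα).2 (by rw [h, hhalf]; exact (hRr β hβ).1)
  have hm : ∀ α ∈ Rr, 1 ≤ mult α := fun α hα => hmult α (hRr α hα).1 (hRr α hα).2
  have hs : ∀ y ∈ U, ∀ α ∈ Rr, Complex.sinh (bil α y) ≠ 0 :=
    fun y hy α hα => hUs y hy α (hRr α hα).1
  have hc : ∀ y ∈ U, ∀ α ∈ Rr, mult2 α ≠ 0 → Complex.cosh (bil α y) ≠ 0 := by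
    intro y hy α hα h2 h
    have hm2 : (2 : ℂ) • α ∈ R := by
      by_contra hn2
      exact h2 ((hmult2 α).2 hn2)
    apply hUs y hy _ hm2
    rw [bil_smul_left, Complex.sinh_two_mul, h, mul_zero]
  have hNs : ∑ α ∈ Rr, (mult α + mult2 α) = N := by
    rw [hN, sum_split R h4 mult]
    refine Finset.sum_congr rfl fun α _ => ?_
    split_ifs with h
    · rw [(hmult2 α).1 h]
    · rw [(hmult2 α).2 h]
  set u : ℂ := ∑ γ ∈ R, (mult γ : ℂ) * ((mult γ : ℂ) + 2 * (mult2 γ : ℂ) + 1) * bil γ γ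
              / (Complex.sinh (bil γ x)) ^ 2 with hu
  have hu' : u = -2 * ∑ α ∈ Rr, bil α α * da (mult α) (mult2 α) (bil α x) := by
    rw [hu, sum_split R h4, Finset.mul_sum]
    refine Finset.sum_congr rfl fun α hα => ?_
    rw [← u_term _ _ _ _ (hs x hx α hα) (hc x hx α hα)]
    congr 1
    split_ifs with h
    · have h5 : mult2 ((2 : ℂ) • α) = 0 := by
        apply (hmult2 _).2
        intro h6
        exact h4 _ h h6 (by rw [hhalf]; exact (hRr α hα).1)
      rw [h5, (hmult2 α).1 h, bil_smul_left, bil_smul_left, bil_smul_right]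
      push_cast
      ring
    · rw [(hmult2 α).2 h]
      simp
  choose P1 P2 hP1 hP2 hder using
    line_data U hUo ψ P N hform hdeg hanal x hx
  let Q : MvPolynomial (Fin n) ℂ :=
    ∑ i, (P2 i + MvPolynomial.C 2 * (MvPolynomial.X i * P1 i)) - MvPolynomial.C u * P x
  have hφ : ∀ z, (∑ i : Fin n,
      iteratedDeriv 2 (fun t : ℂ => ψ z (x + t • (Pi.single i 1 : Fin n → ℂ))) 0)
        - u * ψ z x - bil z z * ψ z x = MvPolynomial.eval z Q * Complex.exp (bil z x) := by
    intro z
    simp only [Q, hder, hform x hx, ← Finset.sum_mul, map_sub, map_sum, map_add, map_mul,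
      MvPolynomial.eval_C, MvPolynomial.eval_X, Finset.sum_add_distrib, bil, pow_two]
    simp only [← Finset.mul_sum, mul_assoc]
    ring
  suffices hQ : Q = 0 by
    intro z
    have := hφ z
    rw [hQ, map_zero, zero_mul] at this
    linear_combination this
  have hQI : ∀ α ∈ Rr, QI Q α (mult α) (mult2 α) (bil α x) := by
    intro α hα
    apply QI_of
    intro s hss w hw
    have hq : ∀ y ∈ U, ψ (w + (s : ℂ) • α) y = ψ (w - (s : ℂ) • α) y := fun y hy =>
      hquasi y hy α (hRr α hα).1 (hRr α hα).2 s hss w hw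
    rw [← hφ, ← hφ, hq x hx]
    have e1 : bil (w + (s : ℂ) • α) (w + (s : ℂ) • α) =
        bil (w - (s : ℂ) • α) (w - (s : ℂ) • α) := by
      rw [bil_add_left, bil_sub_left, bil_comm w, bil_comm w, bil_add_left, bil_sub_left,
        bil_smul_left, bil_smul_left, bil_smul_left, bil_add_right,
        bil_comm α (w - (s : ℂ) • α), bil_sub_left, bil_comm w α, hw]
      rw [bil_smul_right, bil_smul_left]
      ring
    rw [e1]
    congr 2
    refine Finset.sum_congr rfl fun i _ => ?_
    apply Filter.EventuallyEq.iteratedDeriv_eq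
    filter_upwards [line_mem U hUo x hx i] with t ht
    exact hq _ ht
  have hQIP : ∀ y ∈ U, ∀ α ∈ Rr, QI (P y) α (mult α) (mult2 α) (bil α y) := by
    intro y hy α hα
    apply QI_of
    intro s hss w hw
    rw [← hform y hy, ← hform y hy]
    exact hquasi y hy α (hRr α hα).1 (hRr α hα).2 s hss w hw
  set PN : MvPolynomial (Fin n) ℂ := ∏ γ ∈ R, linForm γ ^ mult γ with hPN
  have hPNd : PN.totalDegree ≤ N := by
    rw [← hhc x hx]
    exact (MvPolynomial.homogeneousComponent_isHomogeneous _ _).totalDegree_le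
  have hcoefP : ∀ y ∈ U, ∀ μ : Fin n →₀ ℕ, N ≤ μ.degree →
      MvPolynomial.coeff μ (P y) = MvPolynomial.coeff μ PN := by
    intro y hy μ hμ
    rcases hμ.eq_or_lt with h | h
    · rw [← hhc y hy, MvPolynomial.coeff_homogeneousComponent, if_pos h.symm]
    · rw [coeff_big _ _ (hdeg y hy).le μ h, coeff_big _ _ hPNd μ h]
  have hev : ∀ i, ∀ μ : Fin n →₀ ℕ, N ≤ μ.degree →
      (fun t : ℂ => MvPolynomial.coeff μ (P (x + t • (Pi.single i 1 : Fin n → ℂ))))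
        =ᶠ[nhds 0] fun _ => MvPolynomial.coeff μ PN := by
    intro i μ hμ
    filter_upwards [line_mem U hUo x hx i] with t ht
    exact hcoefP _ ht μ hμ
  have hz1 : ∀ i, ∀ μ : Fin n →₀ ℕ, N ≤ μ.degree → MvPolynomial.coeff μ (P1 i) = 0 := by
    intro i μ hμ
    rw [hP1, (hev i μ hμ).deriv_eq]
    exact deriv_const _ _
  have hz2 : ∀ i, ∀ μ : Fin n →₀ ℕ, N ≤ μ.degree → MvPolynomial.coeff μ (P2 i) = 0 := by
    intro i μ hμ
    rw [hP2, (hev i μ hμ).iteratedDeriv_eq, iteratedDeriv_succ, iteratedDeriv_one]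
    simp
  have hQc : ∀ μ : Fin n →₀ ℕ, N ≤ μ.degree → MvPolynomial.coeff μ Q = 0 := by
    rcases Nat.eq_zero_or_pos N with hN0 | hNpos
    · have hRe : Rr = ∅ := by
        rw [Finset.eq_empty_iff_forall_notMem]
        intro α hα
        have h1 := Finset.sum_eq_zero_iff.1 (hNs.trans hN0) α hα
        have h2 := hm α hα
        omega
      have hu0 : u = 0 := by rw [hu', hRe]; simp
      intro μ _
      have e1 : ∀ i, P1 i = 0 := by
        intro i; ext ν; rw [hz1 i ν (by omega)]; simp
      have e2 : ∀ i, P2 i = 0 := by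
        intro i; ext ν; rw [hz2 i ν (by omega)]; simp
      simp [Q, e1, e2, hu0]
    · obtain ⟨N', rfl⟩ : ∃ N', N = N' + 1 := ⟨N - 1, by omega⟩
      have hBex : ∀ α, ∃ b, α ∈ Rr → linForm α * b = PN := by
        intro α
        by_cases hα : α ∈ Rr
        · have : linForm α ∣ PN := (dvd_pow_self _ (by have := hm α hα; omega)).trans
            (Finset.dvd_prod_of_mem (fun γ => linForm γ ^ mult γ) (hRr α hα).1)
          obtain ⟨b, hb⟩ := this
          exact ⟨b, fun _ => hb.symm⟩
        · exact ⟨0, fun h => absurd h hα⟩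
      choose B hB using hBex
      have hBd : ∀ α ∈ Rr, (B α).totalDegree ≤ N' := fun α hα =>
        B_degree α (h0 α hα) (B α) PN N' hPNd (hB α hα)
      have hsub : ∀ y ∈ U, MvPolynomial.homogeneousComponent N' (P y) =
          - ∑ α ∈ Rr, MvPolynomial.C (bil α α * aa (mult α) (mult2 α) (bil α y)) * B α := by
        intro y hy
        apply sub_top Rr mult mult2 y h0 hind hm (hs y hy) (hc y hy) (P y) (hQIP y hy) N' hNs
          (hdeg y hy).le B
        intro α hα
        rw [hB α hα, hhc y hy]
      have h1' : ∀ i, ∀ μ : Fin n →₀ ℕ, μ.degree = N' →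
          MvPolynomial.coeff μ (P1 i) = - ∑ α ∈ Rr,
            ((bil α α * da (mult α) (mult2 α) (bil α x)) * α i) *
              MvPolynomial.coeff μ (B α) := by
        intro i μ hμ
        have he : (fun t : ℂ => MvPolynomial.coeff μ
            (P (x + t • (Pi.single i 1 : Fin n → ℂ)))) =ᶠ[nhds 0]
            fun t => - ∑ α ∈ Rr, (bil α α * aa (mult α) (mult2 α) (bil α x + t * α i)) *
              MvPolynomial.coeff μ (B α) := by
          filter_upwards [line_mem U hUo x hx i] with t ht
          have h7 := congrArg (MvPolynomial.coeff μ) (hsub _ ht)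
          rw [MvPolynomial.coeff_homogeneousComponent, if_pos hμ, MvPolynomial.coeff_neg,
            MvPolynomial.coeff_sum] at h7
          simpa only [MvPolynomial.coeff_C_mul, bil_add_right, bil_smul_right, bil_single]
            using h7
        rw [hP1, he.deriv_eq]
        apply HasDerivAt.deriv
        apply HasDerivAt.fun_neg
        apply HasDerivAt.fun_sum
        intro α hα
        have hl : HasDerivAt (fun t : ℂ => bil α x + t * α i) (α i) 0 := by
          simpa using ((hasDerivAt_id (0 : ℂ)).mul_const (α i)).const_add (bil α x)
        have ha : HasDerivAt (aa (mult α) (mult2 α)) (da (mult α) (mult2 α) (bil α x))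
            (bil α x + 0 * α i) := by
          rw [zero_mul, add_zero]
          exact aa_deriv _ _ _ (hs x hx α hα) (hc x hx α hα)
        have h8 := HasDerivAt.comp (0 : ℂ) ha hl
        have h9 := (h8.const_mul (bil α α)).mul_const (MvPolynomial.coeff μ (B α))
        refine HasDerivAt.congr_deriv h9 ?_
        ring
      intro μ hμ
      simp only [Q, hu']
      exact core_deg Rr N' B P1 P2 (P x) PN
        (fun α => bil α α * da (mult α) (mult2 α) (bil α x)) hB hBd hz2 hz1 h1'
        (hcoefP x hx) μ hμ
  obtain ⟨hQd, hQt⟩ := deg_of_coeff Q N hQc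
  apply quasi_zero Rr mult mult2 x h0 hind (hs x hx) (hc x hx) Q hQI
  · rw [hNs]; exact hQd
  · rw [hNs]; exact hQt
end

section
/- With the notation below, for every p ∈ R^a_{A₂} there exists q ∈ R^a_{A₂} such that q(z) = D̃₀p(z) for every z ∈ ℂ³ with z_i − z_j ∉ {−1, 0, 1} for all i ≠ j. In other words, the rational Macdonald–Ruijsenaars type operator D̃₀ for the root system A₂ with multiplicity 1 preserves the ring R^a_{A₂} of analytic quasi-invariants. -/
noncomputable section

/-- The set `S₁` of shift vectors. -/
def S1 : List (Fin 3 → ℂ) :=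
  [![3, 0, 0], ![0, 3, 0], ![0, 0, 3], ![2, 2, -1], ![2, -1, 2], ![-1, 2, 2]]

/-- The set `S₂` of shift vectors `2e_i + e_j`, `i ≠ j`. -/
def S2 : List (Fin 3 → ℂ) :=
  [![2, 1, 0], ![2, 0, 1], ![1, 2, 0], ![0, 2, 1], ![1, 0, 2], ![0, 1, 2]]

open scoped Classical in
/-- The coefficient `c_τ` for `τ ∈ S₂`. -/
def cS2 (τ z : Fin 3 → ℂ) : ℂ :=
  3 * (∏ i : Fin 3, ∏ j : Fin 3,
        if i ≠ j ∧ τ i - τ j = 1 then 1 - 1 / (z i - z j - 1) else 1) *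
    (∏ i : Fin 3, ∏ j : Fin 3,
        if i ≠ j ∧ τ i - τ j = 2 then 1 - 2 / (z i - z j) else 1)

open scoped Classical in
/-- The coefficient `c_τ` for `τ ∈ S₁`. -/
def cS1 (τ z : Fin 3 → ℂ) : ℂ :=
  ∏ i : Fin 3, ∏ j : Fin 3,
    if i ≠ j ∧ τ i - τ j = 3 then 1 - 3 / (z i - z j + 1) else 1

/-- The rational Macdonald–Ruijsenaars type operator `D̃₀` for the root system
`A₂` with multiplicity `1`. -/
def applyD0 (p : (Fin 3 → ℂ) → ℂ) (z : Fin 3 → ℂ) : ℂ :=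
  (S1.map (fun τ => cS1 τ z * p (z + τ))).sum +
    (S2.map (fun τ => cS2 τ z * p (z + τ))).sum

/-- The ring `R^a_{A₂}` of analytic quasi-invariants of type `A₂`. -/
def RaA2 (p : (Fin 3 → ℂ) → ℂ) : Prop :=
  (∀ z, AnalyticAt ℂ p z) ∧
  ∀ i j : Fin 3, i ≠ j → ∀ z : Fin 3 → ℂ, z i = z j →
    p (z + Pi.single i 1 - Pi.single j 1) = p (z - Pi.single i 1 + Pi.single j 1)

set_option linter.unusedSimpArgs false
set_option linter.unusedVariables false


section Division
open Filter Topology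
variable {E : Type*} [NormedAddCommGroup E] [NormedSpace ℂ E]

/-- The series of the quotient by a linear form. -/
noncomputable def quotSeries (p : FormalMultilinearSeries ℂ E ℂ) (A : E →L[ℂ] E) (v : E) :
    FormalMultilinearSeries ℂ E ℂ := fun n =>
  ∑ k : Fin (n + 1), (ContinuousMultilinearMap.curryMid k (p (n + 1)) v).compContinuousLinearMap
    (fun i => if i.castSucc < k then A else ContinuousLinearMap.id ℂ E)

theorem quotSeries_apply (p : FormalMultilinearSeries ℂ E ℂ) (l : E →L[ℂ] ℂ) (A : E →L[ℂ] E)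
    (v : E) (hA : ∀ y, y - A y = l y • v) (n : ℕ) (y : E) :
    l y * quotSeries p A v n (fun _ => y) =
      p (n + 1) (fun _ => y) - p (n + 1) (fun _ => A y) := by
  set m : ℕ → Fin (n + 1) → E := fun k i => if (i : ℕ) < k then A y else y with hm
  have h0 : (fun _ => y) = m 0 := by ext i; simp [hm]
  have h1 : (fun _ => A y) = m (n + 1) := by ext i; simp [hm, i.2]
  have hstep : ∀ k : Fin (n + 1), l y * (p (n + 1)) (k.insertNth v
      (fun i => if i.castSucc < k then A y else y)) =
      p (n + 1) (m k) - p (n + 1) (m (k + 1)) := by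
    intro k
    have e1 : m k = Function.update (m k) k y := by
      ext i
      by_cases h : i = k
      · subst h; simp [hm]
      · simp [h]
    have e2 : m (k + 1) = Function.update (m k) k (A y) := by
      ext i
      by_cases h : i = k
      · subst h; simp [hm]
      · have h' : (i : ℕ) ≠ k := fun h' => h (Fin.ext h')
        have : (i : ℕ) < k + 1 ↔ (i : ℕ) < k := by omega
        simp [h, hm, this]
    have e3 : k.insertNth v (fun i => if i.castSucc < k then A y else y)
        = Function.update (m k) k v := by
      ext j
      refine Fin.succAboveCases k ?_ (fun i => ?_) j
      · simp
      · have := @Fin.succAbove_lt_iff_castSucc_lt _ k i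
        simp only [Fin.insertNth_apply_succAbove, ne_eq, Fin.succAbove_ne, not_false_eq_true,
          Function.update_of_ne, hm]
        rw [Fin.lt_def] at this
        simp only [this]
    rw [e2]
    conv_rhs => rw [e1]
    rw [Function.update_idem, ← ContinuousMultilinearMap.map_update_sub, hA, e3,
      ContinuousMultilinearMap.map_update_smul, smul_eq_mul]
  rw [h0, h1]
  have : quotSeries p A v n (fun _ => y) = ∑ k : Fin (n + 1), (p (n + 1)) (k.insertNth v
      (fun i => if i.castSucc < k then A y else y)) := by
    simp only [quotSeries, _root_.sum_apply,
      ContinuousMultilinearMap.compContinuousLinearMap_apply,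
      ContinuousMultilinearMap.curryMid_apply]
    refine Finset.sum_congr rfl fun k _ => ?_
    congr 2
    ext i
    split_ifs <;> simp
  rw [this, Finset.mul_sum, Finset.sum_congr rfl (fun k _ => hstep k),
    Fin.sum_univ_eq_sum_range (fun k => p (n + 1) (m k) - p (n + 1) (m (k + 1))),
    Finset.sum_range_sub']

theorem quotSeries_radius (p : FormalMultilinearSeries ℂ E ℂ) (hp : 0 < p.radius)
    (A : E →L[ℂ] E) (v : E) : 0 < (quotSeries p A v).radius := by
  obtain ⟨C, r, hC, hr, hb⟩ := p.le_mul_pow_of_radius_pos hp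
  set M : ℝ := max 1 ‖A‖ with hM
  have hM1 : 1 ≤ M := le_max_left _ _
  have hM0 : 0 < M := by linarith
  have hq : ∀ n, ‖quotSeries p A v n‖ ≤ (C * r * ‖v‖) * (2 * r * M) ^ n := by
    intro n
    have hk : ∀ k : Fin (n + 1), ‖(ContinuousMultilinearMap.curryMid k (p (n + 1)) v).compContinuousLinearMap
        (fun i => if i.castSucc < k then A else ContinuousLinearMap.id ℂ E)‖
        ≤ (C * r ^ (n + 1) * ‖v‖) * M ^ n := by
      intro k
      refine (ContinuousMultilinearMap.norm_compContinuousLinearMap_le _ _).trans ?_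
      gcongr
      · refine (ContinuousLinearMap.le_opNorm _ _).trans ?_
        rw [ContinuousMultilinearMap.norm_curryMid]
        gcongr
        exact hb _
      · refine (Finset.prod_le_prod (fun _ _ => norm_nonneg _) (g := fun _ => M) ?_).trans ?_
        · intro i _
          split_ifs
          · exact le_max_right _ _
          · exact ContinuousLinearMap.norm_id_le.trans hM1
        · simp
    refine (norm_sum_le _ _).trans ((Finset.sum_le_sum fun k _ => hk k).trans ?_)
    have h2 : ((n : ℝ) + 1) ≤ 2 ^ n := by
      exact_mod_cast Nat.lt_two_pow_self
    simp only [Finset.sum_const, Finset.card_univ, Fintype.card_fin, nsmul_eq_mul]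
    push_cast
    calc ((n : ℝ) + 1) * (C * r ^ (n + 1) * ‖v‖ * M ^ n)
        ≤ 2 ^ n * (C * r ^ (n + 1) * ‖v‖ * M ^ n) := by gcongr
      _ = _ := by ring
  have hpos : 0 < (2 * r * M) := by positivity
  obtain ⟨ρ, hρ⟩ : ∃ ρ : NNReal, (ρ : ℝ) = (2 * r * M)⁻¹ := ⟨NNReal.mk (2 * r * M)⁻¹ (by positivity), rfl⟩
  have := (quotSeries p A v).le_radius_of_bound (r := ρ)
    (C * r * ‖v‖) (fun n => by
      refine (mul_le_mul_of_nonneg_right (hq n) (by positivity)).trans ?_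
      rw [hρ, mul_assoc, ← mul_pow, mul_inv_cancel₀ hpos.ne', one_pow, mul_one])
  refine lt_of_lt_of_le ?_ this
  rw [ENNReal.coe_pos, ← NNReal.coe_pos, hρ]
  exact inv_pos.2 hpos

theorem local_div (f : E → ℂ) (z : E) (hf : AnalyticAt ℂ f z) (l : E →L[ℂ] ℂ) (v : E)
    (hv : l v = 1) (h0 : ∀ y, l y = l z → f y = 0) :
    ∃ G : E → ℂ, AnalyticAt ℂ G z ∧ ∀ᶠ y in 𝓝 z, f y = (l y - l z) * G y := by
  obtain ⟨p, hp⟩ := hf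
  set A : E →L[ℂ] E := ContinuousLinearMap.id ℂ E - l.smulRight v with hAdef
  have hA : ∀ y, y - A y = l y • v := by intro y; simp [hAdef]
  have hlA : ∀ y, l (A y) = 0 := by intro y; simp [hAdef, hv]
  have hrad := quotSeries_radius p hp.radius_pos A v
  have hs := ((quotSeries p A v).hasFPowerSeriesOnBall hrad)
  refine ⟨fun y => (quotSeries p A v).sum (y - z), ?_, ?_⟩
  · have h1 : AnalyticAt ℂ (quotSeries p A v).sum (z - z) := by
      rw [sub_self]; exact hs.analyticAt
    exact h1.comp (f := fun y => y - z) (by fun_prop)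
  · have e1 := hs.hasFPowerSeriesAt.eventually_hasSum
    have e2 := hp.eventually_hasSum
    have hAt : Tendsto A (𝓝 0) (𝓝 0) := by
      simpa using A.continuous.tendsto 0
    have e3 := hAt.eventually e2
    have hsub : Tendsto (fun y => y - z) (𝓝 z) (𝓝 0) := by
      have : Continuous fun y : E => y - z := by fun_prop
      simpa using this.tendsto z
    filter_upwards [hsub.eventually (e1.and (e2.and e3))] with y hy
    obtain ⟨a1, a2, a3⟩ := hy
    set w := y - z with hw
    have hy' : y = z + w := by simp [hw]
    have hz : f (z + A w) = 0 := h0 _ (by simp [hlA])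
    have b := (a2.sub a3)
    rw [hz, sub_zero] at b
    have b' := (hasSum_nat_add_iff' 1).2 b
    have hb0 : ∑ i ∈ Finset.range 1, ((p i fun _ => w) - p i fun _ => A w) = 0 := by
      simp only [Finset.sum_range_one]
      rw [sub_eq_zero]
      congr 1
      ext i; exact i.elim0
    rw [hb0, sub_zero] at b'
    have c := a1.mul_left (l w)
    simp only [quotSeries_apply p l A v hA] at c
    have := b'.unique c
    rw [hy', this, zero_add]
    simp

/-- Division of an entire function by an affine form. -/
theorem global_div (f : E → ℂ) (hf : ∀ z, AnalyticAt ℂ f z) (l : E →L[ℂ] ℂ) (a : ℂ) (v : E)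
    (hv : l v = 1) (h0 : ∀ y, l y = a → f y = 0) :
    ∃ g : E → ℂ, (∀ z, AnalyticAt ℂ g z) ∧ ∀ y, f y = (l y - a) * g y := by
  classical
  set g : E → ℂ := fun z => if l z = a then limUnder (𝓝[≠] (0 : ℂ)) (fun t => f (z + t • v) / t)
    else f z / (l z - a) with hg
  refine ⟨g, fun z => ?_, fun y => ?_⟩
  · by_cases hz : l z = a
    · obtain ⟨G, hG, hGe⟩ := local_div f z (hf z) l v hv (fun y hy => h0 y (hy.trans hz))
      refine hG.congr ?_
      filter_upwards [hGe.eventually_nhds, hG.eventually_analyticAt] with y hy hGy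
      rw [hz] at hy
      by_cases hya : l y = a
      · simp only [hg, hya, if_true]
        symm
        apply Tendsto.limUnder_eq
        have hc : Tendsto (fun t : ℂ => y + t • v) (𝓝 0) (𝓝 y) := by
          have : Continuous fun t : ℂ => y + t • v := by fun_prop
          simpa using this.tendsto 0
        have ht : Tendsto (fun t : ℂ => G (y + t • v)) (𝓝[≠] 0) (𝓝 (G y)) :=
          (hGy.continuousAt.tendsto.comp hc).mono_left nhdsWithin_le_nhds
        refine ht.congr' ?_
        filter_upwards [nhdsWithin_le_nhds (hc.eventually hy), self_mem_nhdsWithin] with t h1 h2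
        rw [h1]
        have h2' : t ≠ 0 := h2
        simp [hv, hya]
        field_simp
      · simp only [hg, hya, if_false]
        rw [hy.self_of_nhds]
        have : l y - a ≠ 0 := sub_ne_zero.2 hya
        field_simp
    · have h1 : AnalyticAt ℂ (fun z => f z / (l z - a)) z :=
        (hf z).div ((l.analyticAt z).sub analyticAt_const) (sub_ne_zero.2 hz)
      refine h1.congr ?_
      have : ∀ᶠ y in 𝓝 z, l y ≠ a := l.continuous.continuousAt.eventually_ne hz
      filter_upwards [this] with y hy
      simp [hg, hy]
  · by_cases hya : l y = a
    · simp [h0 y hya, hya]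
    · have : l y - a ≠ 0 := sub_ne_zero.2 hya
      simp only [hg, hya, if_false]
      field_simp

end Division

section Algebra

/-- Cleared factor for a pair with difference `3`. -/
noncomputable def kf3 (d : ℂ) : ℂ := (d - 2) * (d - 1) * d

/-- Cleared factor for a pair with difference `-3`. -/
noncomputable def kfm3 (d : ℂ) : ℂ := (d + 2) * d * (d + 1)

/-- Cleared factor for a pair with difference `1`. -/
noncomputable def kf1 (d : ℂ) : ℂ := (d - 2) * d * (d + 1)

/-- Cleared factor for a pair with difference `-1`. -/
noncomputable def kfm1 (d : ℂ) : ℂ := (d + 2) * (d - 1) * d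

/-- Cleared factor for a pair with difference `2`. -/
noncomputable def kf2 (d : ℂ) : ℂ := (d - 2) * (d - 1) * (d + 1)

/-- Cleared factor for a pair with difference `-2`. -/
noncomputable def kfm2 (d : ℂ) : ℂ := (d + 2) * (d - 1) * (d + 1)

/-- Cleared factor for a pair with difference `0`. -/
noncomputable def kf0 (d : ℂ) : ℂ := (d - 1) * d * (d + 1)

/-- The common denominator. -/
noncomputable def Pf (a b c : ℂ) : ℂ := kf0 (a - b) * kf0 (a - c) * kf0 (b - c)

/-- The numerator. -/
noncomputable def Nf (F : ℂ → ℂ → ℂ → ℂ) (a b c : ℂ) : ℂ :=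
  kf3 (a - b) * kf3 (a - c) * kf0 (b - c) * F (a + 3) b c +
  kfm3 (a - b) * kf0 (a - c) * kf3 (b - c) * F a (b + 3) c +
  kf0 (a - b) * kfm3 (a - c) * kfm3 (b - c) * F a b (c + 3) +
  kf0 (a - b) * kf3 (a - c) * kf3 (b - c) * F (a + 2) (b + 2) (c - 1) +
  kf3 (a - b) * kf0 (a - c) * kfm3 (b - c) * F (a + 2) (b - 1) (c + 2) +
  kfm3 (a - b) * kfm3 (a - c) * kf0 (b - c) * F (a - 1) (b + 2) (c + 2) +
  3 * kf1 (a - b) * kf2 (a - c) * kf1 (b - c) * F (a + 2) (b + 1) c +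
  3 * kf2 (a - b) * kf1 (a - c) * kfm1 (b - c) * F (a + 2) b (c + 1) +
  3 * kfm1 (a - b) * kf1 (a - c) * kf2 (b - c) * F (a + 1) (b + 2) c +
  3 * kfm2 (a - b) * kfm1 (a - c) * kf1 (b - c) * F a (b + 2) (c + 1) +
  3 * kf1 (a - b) * kfm1 (a - c) * kfm2 (b - c) * F (a + 1) b (c + 2) +
  3 * kfm1 (a - b) * kfm2 (a - c) * kfm1 (b - c) * F a (b + 1) (c + 2)

variable (F : ℂ → ℂ → ℂ → ℂ)

theorem Nf_van_01_0 (h : ∀ a b c a' b', a = b + 2 → a' = b → b' = a → F a b c = F a' b' c) (b c : ℂ) :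
    Nf F b b c = 0 := by
  have e0 : F (b + 2) b (c + 1) = F b (b + 2) (c + 1) :=
    h _ _ _ _ _ (by ring) (by ring) (by ring)
  simp only [Nf]
  rw [e0]
  simp only [kf3, kfm3, kf1, kfm1, kf2, kfm2, kf0]
  ring

theorem Nf_van_01_1 (h : ∀ a b c a' b', a = b + 2 → a' = b → b' = a → F a b c = F a' b' c) (b c : ℂ) :
    Nf F (b + 1) b c = 0 := by
  have e0 : F (b + 1 + 2) (b + 1) c = F (b + 1) (b + 3) c :=
    h _ _ _ _ _ (by ring) (by ring) (by ring)
  have e1 : F (b + 1 + 1) b (c + 2) = F (b + 1 - 1) (b + 2) (c + 2) :=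
    h _ _ _ _ _ (by ring) (by ring) (by ring)
  simp only [Nf]
  rw [e0, e1]
  simp only [kf3, kfm3, kf1, kfm1, kf2, kfm2, kf0]
  ring

theorem Nf_van_01_m1 (h : ∀ a b c a' b', a = b + 2 → a' = b → b' = a → F a b c = F a' b' c) (b c : ℂ) :
    Nf F (b - 1) b c = 0 := by
  have e0 : F (b - 1 + 3) b c = F (b - 1 + 1) (b + 2) c :=
    h _ _ _ _ _ (by ring) (by ring) (by ring)
  have e1 : F (b - 1 + 2) (b - 1) (c + 2) = F (b - 1) (b + 1) (c + 2) :=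
    h _ _ _ _ _ (by ring) (by ring) (by ring)
  simp only [Nf]
  rw [e0, e1]
  simp only [kf3, kfm3, kf1, kfm1, kf2, kfm2, kf0]
  ring

theorem Nf_qi_01 (h : ∀ a b c a' b', a = b + 2 → a' = b → b' = a → F a b c = F a' b' c) (t c : ℂ) :
    Nf F (t + 1) (t - 1) c = - Nf F (t - 1) (t + 1) c := by
  have e0 : F (t + 1) (t - 1 + 3) c = F (t - 1 + 2) (t + 1 + 1) c := by ring_nf
  have e1 : F (t + 1) (t - 1) (c + 3) = F (t - 1) (t + 1) (c + 3) := h _ _ _ _ _ (by ring) (by ring) (by ring)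
  have e2 : F (t + 1 + 2) (t - 1 + 2) (c - 1) = F (t - 1 + 2) (t + 1 + 2) (c - 1) := h _ _ _ _ _ (by ring) (by ring) (by ring)
  have e3 : F (t + 1 - 1) (t - 1 + 2) (c + 2) = F (t - 1 + 1) (t + 1) (c + 2) := by ring_nf
  have e4 : F (t + 1 + 1) (t - 1 + 2) c = F (t - 1 + 3) (t + 1) c := by ring_nf
  have e5 : F (t + 1) (t - 1 + 2) (c + 1) = F (t - 1 + 2) (t + 1) (c + 1) := by ring_nf
  have e6 : F (t + 1) (t - 1 + 1) (c + 2) = F (t - 1 + 2) (t + 1 - 1) (c + 2) := by ring_nf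
  simp only [Nf]
  rw [e0, e1, e2, e3, e4, e5, e6]
  simp only [kf3, kfm3, kf1, kfm1, kf2, kfm2, kf0]
  ring

theorem Nf_van_02_0 (h : ∀ a b c a' c', a = c + 2 → a' = c → c' = a → F a b c = F a' b c') (b c : ℂ) :
    Nf F c b c = 0 := by
  have e0 : F (c + 2) (b + 1) c = F c (b + 1) (c + 2) :=
    h _ _ _ _ _ (by ring) (by ring) (by ring)
  simp only [Nf]
  rw [e0]
  simp only [kf3, kfm3, kf1, kfm1, kf2, kfm2, kf0]
  ring

theorem Nf_van_02_1 (h : ∀ a b c a' c', a = c + 2 → a' = c → c' = a → F a b c = F a' b c') (b c : ℂ) :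
    Nf F (c + 1) b c = 0 := by
  have e0 : F (c + 1 + 2) b (c + 1) = F (c + 1) b (c + 3) :=
    h _ _ _ _ _ (by ring) (by ring) (by ring)
  have e1 : F (c + 1 + 1) (b + 2) c = F (c + 1 - 1) (b + 2) (c + 2) :=
    h _ _ _ _ _ (by ring) (by ring) (by ring)
  simp only [Nf]
  rw [e0, e1]
  simp only [kf3, kfm3, kf1, kfm1, kf2, kfm2, kf0]
  ring

theorem Nf_van_02_m1 (h : ∀ a b c a' c', a = c + 2 → a' = c → c' = a → F a b c = F a' b c') (b c : ℂ) :
    Nf F (c - 1) b c = 0 := by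
  have e0 : F (c - 1 + 3) b c = F (c - 1 + 1) b (c + 2) :=
    h _ _ _ _ _ (by ring) (by ring) (by ring)
  have e1 : F (c - 1 + 2) (b + 2) (c - 1) = F (c - 1) (b + 2) (c + 1) :=
    h _ _ _ _ _ (by ring) (by ring) (by ring)
  simp only [Nf]
  rw [e0, e1]
  simp only [kf3, kfm3, kf1, kfm1, kf2, kfm2, kf0]
  ring

theorem Nf_qi_02 (h : ∀ a b c a' c', a = c + 2 → a' = c → c' = a → F a b c = F a' b c') (t b : ℂ) :
    Nf F (t + 1) b (t - 1) = - Nf F (t - 1) b (t + 1) := by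
  have e0 : F (t + 1) (b + 3) (t - 1) = F (t - 1) (b + 3) (t + 1) := h _ _ _ _ _ (by ring) (by ring) (by ring)
  have e1 : F (t + 1) b (t - 1 + 3) = F (t - 1 + 2) b (t + 1 + 1) := by ring_nf
  have e2 : F (t + 1 + 2) (b - 1) (t - 1 + 2) = F (t - 1 + 2) (b - 1) (t + 1 + 2) := h _ _ _ _ _ (by ring) (by ring) (by ring)
  have e3 : F (t + 1 - 1) (b + 2) (t - 1 + 2) = F (t - 1 + 1) (b + 2) (t + 1) := by ring_nf
  have e4 : F (t + 1) (b + 2) (t - 1 + 1) = F (t - 1 + 2) (b + 2) (t + 1 - 1) := by ring_nf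
  have e5 : F (t + 1 + 1) b (t - 1 + 2) = F (t - 1 + 3) b (t + 1) := by ring_nf
  have e6 : F (t + 1) (b + 1) (t - 1 + 2) = F (t - 1 + 2) (b + 1) (t + 1) := by ring_nf
  simp only [Nf]
  rw [e0, e1, e2, e3, e4, e5, e6]
  simp only [kf3, kfm3, kf1, kfm1, kf2, kfm2, kf0]
  ring

theorem Nf_van_12_0 (h : ∀ a b c b' c', b = c + 2 → b' = c → c' = b → F a b c = F a b' c') (a c : ℂ) :
    Nf F a c c = 0 := by
  have e0 : F (a + 1) (c + 2) c = F (a + 1) c (c + 2) :=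
    h _ _ _ _ _ (by ring) (by ring) (by ring)
  simp only [Nf]
  rw [e0]
  simp only [kf3, kfm3, kf1, kfm1, kf2, kfm2, kf0]
  ring

theorem Nf_van_12_1 (h : ∀ a b c b' c', b = c + 2 → b' = c → c' = b → F a b c = F a b' c') (a c : ℂ) :
    Nf F a (c + 1) c = 0 := by
  have e0 : F (a + 2) (c + 1 + 1) c = F (a + 2) (c + 1 - 1) (c + 2) :=
    h _ _ _ _ _ (by ring) (by ring) (by ring)
  have e1 : F a (c + 1 + 2) (c + 1) = F a (c + 1) (c + 3) :=
    h _ _ _ _ _ (by ring) (by ring) (by ring)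
  simp only [Nf]
  rw [e0, e1]
  simp only [kf3, kfm3, kf1, kfm1, kf2, kfm2, kf0]
  ring

theorem Nf_van_12_m1 (h : ∀ a b c b' c', b = c + 2 → b' = c → c' = b → F a b c = F a b' c') (a c : ℂ) :
    Nf F a (c - 1) c = 0 := by
  have e0 : F a (c - 1 + 3) c = F a (c - 1 + 1) (c + 2) :=
    h _ _ _ _ _ (by ring) (by ring) (by ring)
  have e1 : F (a + 2) (c - 1 + 2) (c - 1) = F (a + 2) (c - 1) (c + 1) :=
    h _ _ _ _ _ (by ring) (by ring) (by ring)
  simp only [Nf]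
  rw [e0, e1]
  simp only [kf3, kfm3, kf1, kfm1, kf2, kfm2, kf0]
  ring

theorem Nf_qi_12 (h : ∀ a b c b' c', b = c + 2 → b' = c → c' = b → F a b c = F a b' c') (t a : ℂ) :
    Nf F a (t + 1) (t - 1) = - Nf F a (t - 1) (t + 1) := by
  have e0 : F (a + 3) (t + 1) (t - 1) = F (a + 3) (t - 1) (t + 1) := h _ _ _ _ _ (by ring) (by ring) (by ring)
  have e1 : F a (t + 1) (t - 1 + 3) = F a (t - 1 + 2) (t + 1 + 1) := by ring_nf
  have e2 : F (a + 2) (t + 1 - 1) (t - 1 + 2) = F (a + 2) (t - 1 + 1) (t + 1) := by ring_nf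
  have e3 : F (a - 1) (t + 1 + 2) (t - 1 + 2) = F (a - 1) (t - 1 + 2) (t + 1 + 2) := h _ _ _ _ _ (by ring) (by ring) (by ring)
  have e4 : F (a + 2) (t + 1) (t - 1 + 1) = F (a + 2) (t - 1 + 2) (t + 1 - 1) := by ring_nf
  have e5 : F (a + 1) (t + 1) (t - 1 + 2) = F (a + 1) (t - 1 + 2) (t + 1) := by ring_nf
  have e6 : F a (t + 1 + 1) (t - 1 + 2) = F a (t - 1 + 3) (t + 1) := by ring_nf
  simp only [Nf]
  rw [e0, e1, e2, e3, e4, e5, e6]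
  simp only [kf3, kfm3, kf1, kfm1, kf2, kfm2, kf0]
  ring

end Algebra

open Classical in
theorem cS1_eq (x y w : ℂ) (z : Fin 3 → ℂ) : cS1 ![x, y, w] z =
    (if x - y = 3 then 1 - 3 / (z 0 - z 1 + 1) else 1) *
    (if x - w = 3 then 1 - 3 / (z 0 - z 2 + 1) else 1) *
    (if y - x = 3 then 1 - 3 / (z 1 - z 0 + 1) else 1) *
    (if y - w = 3 then 1 - 3 / (z 1 - z 2 + 1) else 1) *
    (if w - x = 3 then 1 - 3 / (z 2 - z 0 + 1) else 1) *
    (if w - y = 3 then 1 - 3 / (z 2 - z 1 + 1) else 1) := by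
  have e0 : (![x, y, w] : Fin 3 → ℂ) 0 = x := rfl
  have e1 : (![x, y, w] : Fin 3 → ℂ) 1 = y := rfl
  have e2 : (![x, y, w] : Fin 3 → ℂ) 2 = w := rfl
  have d01 : (0 : Fin 3) ≠ 1 := by decide
  have d02 : (0 : Fin 3) ≠ 2 := by decide
  have d12 : (1 : Fin 3) ≠ 2 := by decide
  simp only [cS1, Fin.prod_univ_three, e0, e1, e2, ne_eq, d01, d02, d12, d01.symm, d02.symm,
    d12.symm, not_true, not_false_eq_true, true_and, false_and, if_false, one_mul, mul_one]
  ring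

open Classical in
theorem cS2_eq (x y w : ℂ) (z : Fin 3 → ℂ) : cS2 ![x, y, w] z =
    3 * ((if x - y = 1 then 1 - 1 / (z 0 - z 1 - 1) else 1) *
    (if x - w = 1 then 1 - 1 / (z 0 - z 2 - 1) else 1) *
    (if y - x = 1 then 1 - 1 / (z 1 - z 0 - 1) else 1) *
    (if y - w = 1 then 1 - 1 / (z 1 - z 2 - 1) else 1) *
    (if w - x = 1 then 1 - 1 / (z 2 - z 0 - 1) else 1) *
    (if w - y = 1 then 1 - 1 / (z 2 - z 1 - 1) else 1)) *
    ((if x - y = 2 then 1 - 2 / (z 0 - z 1) else 1) *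
    (if x - w = 2 then 1 - 2 / (z 0 - z 2) else 1) *
    (if y - x = 2 then 1 - 2 / (z 1 - z 0) else 1) *
    (if y - w = 2 then 1 - 2 / (z 1 - z 2) else 1) *
    (if w - x = 2 then 1 - 2 / (z 2 - z 0) else 1) *
    (if w - y = 2 then 1 - 2 / (z 2 - z 1) else 1)) := by
  have e0 : (![x, y, w] : Fin 3 → ℂ) 0 = x := rfl
  have e1 : (![x, y, w] : Fin 3 → ℂ) 1 = y := rfl
  have e2 : (![x, y, w] : Fin 3 → ℂ) 2 = w := rfl
  have d01 : (0 : Fin 3) ≠ 1 := by decide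
  have d02 : (0 : Fin 3) ≠ 2 := by decide
  have d12 : (1 : Fin 3) ≠ 2 := by decide
  simp only [cS2, Fin.prod_univ_three, e0, e1, e2, ne_eq, d01, d02, d12, d01.symm, d02.symm,
    d12.symm, not_true, not_false_eq_true, true_and, false_and, if_false, one_mul, mul_one,
    mul_assoc]

set_option maxHeartbeats 4000000 in
theorem Nf_eq (p : (Fin 3 → ℂ) → ℂ) (z : Fin 3 → ℂ)
    (h01 : z 0 - z 1 ≠ 0) (h01p : z 0 - z 1 - 1 ≠ 0) (h01m : z 0 - z 1 + 1 ≠ 0)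
    (h02 : z 0 - z 2 ≠ 0) (h02p : z 0 - z 2 - 1 ≠ 0) (h02m : z 0 - z 2 + 1 ≠ 0)
    (h12 : z 1 - z 2 ≠ 0) (h12p : z 1 - z 2 - 1 ≠ 0) (h12m : z 1 - z 2 + 1 ≠ 0) :
    Nf (fun a b c => p ![a, b, c]) (z 0) (z 1) (z 2) = Pf (z 0) (z 1) (z 2) * applyD0 p z := by
  have k01 : z 1 - z 0 = -(z 0 - z 1) := by ring
  have k02 : z 2 - z 0 = -(z 0 - z 2) := by ring
  have k12 : z 2 - z 1 = -(z 1 - z 2) := by ring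
  have h01n : -(z 0 - z 1) - 1 ≠ 0 := fun h => h01m (by linear_combination -h)
  have h02n : -(z 0 - z 2) - 1 ≠ 0 := fun h => h02m (by linear_combination -h)
  have h12n : -(z 1 - z 2) - 1 ≠ 0 := fun h => h12m (by linear_combination -h)
  have h01q : -(z 0 - z 1) + 1 ≠ 0 := fun h => h01p (by linear_combination -h)
  have h02q : -(z 0 - z 2) + 1 ≠ 0 := fun h => h02p (by linear_combination -h)
  have h12q : -(z 1 - z 2) + 1 ≠ 0 := fun h => h12p (by linear_combination -h)
  have hv : ∀ x y w : ℂ, z + ![x, y, w] = ![z 0 + x, z 1 + y, z 2 + w] := by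
    intro x y w; ext i; fin_cases i <;> simp
  have c0 : Pf (z 0) (z 1) (z 2) * cS1 ![3, 0, 0] z = kf3 (z 0 - z 1) * kf3 (z 0 - z 2) * kf0 (z 1 - z 2) := by
    have : cS1 ![3, 0, 0] z = (1 - 3 / ((z 0 - z 1) + 1)) * (1 - 3 / ((z 0 - z 2) + 1)) := by
      rw [cS1_eq, k01, k02, k12]
      norm_num only [if_true, if_false, one_mul, mul_one]
      try ring
    rw [this]
    simp only [Pf, kf3, kfm3, kf1, kfm1, kf2, kfm2, kf0]
    field_simp
    try ring
  have c1 : Pf (z 0) (z 1) (z 2) * cS1 ![0, 3, 0] z = kfm3 (z 0 - z 1) * kf0 (z 0 - z 2) * kf3 (z 1 - z 2) := by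
    have : cS1 ![0, 3, 0] z = (1 - 3 / ((-(z 0 - z 1)) + 1)) * (1 - 3 / ((z 1 - z 2) + 1)) := by
      rw [cS1_eq, k01, k02, k12]
      norm_num only [if_true, if_false, one_mul, mul_one]
      try ring
    rw [this]
    simp only [Pf, kf3, kfm3, kf1, kfm1, kf2, kfm2, kf0]
    field_simp
    try ring
  have c2 : Pf (z 0) (z 1) (z 2) * cS1 ![0, 0, 3] z = kf0 (z 0 - z 1) * kfm3 (z 0 - z 2) * kfm3 (z 1 - z 2) := by
    have : cS1 ![0, 0, 3] z = (1 - 3 / ((-(z 0 - z 2)) + 1)) * (1 - 3 / ((-(z 1 - z 2)) + 1)) := by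
      rw [cS1_eq, k01, k02, k12]
      norm_num only [if_true, if_false, one_mul, mul_one]
      try ring
    rw [this]
    simp only [Pf, kf3, kfm3, kf1, kfm1, kf2, kfm2, kf0]
    field_simp
    try ring
  have c3 : Pf (z 0) (z 1) (z 2) * cS1 ![2, 2, -1] z = kf0 (z 0 - z 1) * kf3 (z 0 - z 2) * kf3 (z 1 - z 2) := by
    have : cS1 ![2, 2, -1] z = (1 - 3 / ((z 0 - z 2) + 1)) * (1 - 3 / ((z 1 - z 2) + 1)) := by
      rw [cS1_eq, k01, k02, k12]
      norm_num only [if_true, if_false, one_mul, mul_one]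
      try ring
    rw [this]
    simp only [Pf, kf3, kfm3, kf1, kfm1, kf2, kfm2, kf0]
    field_simp
    try ring
  have c4 : Pf (z 0) (z 1) (z 2) * cS1 ![2, -1, 2] z = kf3 (z 0 - z 1) * kf0 (z 0 - z 2) * kfm3 (z 1 - z 2) := by
    have : cS1 ![2, -1, 2] z = (1 - 3 / ((z 0 - z 1) + 1)) * (1 - 3 / ((-(z 1 - z 2)) + 1)) := by
      rw [cS1_eq, k01, k02, k12]
      norm_num only [if_true, if_false, one_mul, mul_one]
      try ring
    rw [this]
    simp only [Pf, kf3, kfm3, kf1, kfm1, kf2, kfm2, kf0]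
    field_simp
    try ring
  have c5 : Pf (z 0) (z 1) (z 2) * cS1 ![-1, 2, 2] z = kfm3 (z 0 - z 1) * kfm3 (z 0 - z 2) * kf0 (z 1 - z 2) := by
    have : cS1 ![-1, 2, 2] z = (1 - 3 / ((-(z 0 - z 1)) + 1)) * (1 - 3 / ((-(z 0 - z 2)) + 1)) := by
      rw [cS1_eq, k01, k02, k12]
      norm_num only [if_true, if_false, one_mul, mul_one]
      try ring
    rw [this]
    simp only [Pf, kf3, kfm3, kf1, kfm1, kf2, kfm2, kf0]
    field_simp
    try ring
  have c6 : Pf (z 0) (z 1) (z 2) * cS2 ![2, 1, 0] z = 3 * kf1 (z 0 - z 1) * kf2 (z 0 - z 2) * kf1 (z 1 - z 2) := by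
    have : cS2 ![2, 1, 0] z = 3 * (1 - 1 / ((z 0 - z 1) - 1)) * (1 - 2 / (z 0 - z 2)) * (1 - 1 / ((z 1 - z 2) - 1)) := by
      rw [cS2_eq, k01, k02, k12]
      norm_num only [if_true, if_false, one_mul, mul_one]
      try ring
    rw [this]
    simp only [Pf, kf3, kfm3, kf1, kfm1, kf2, kfm2, kf0]
    field_simp
    try ring
  have c7 : Pf (z 0) (z 1) (z 2) * cS2 ![2, 0, 1] z = 3 * kf2 (z 0 - z 1) * kf1 (z 0 - z 2) * kfm1 (z 1 - z 2) := by
    have : cS2 ![2, 0, 1] z = 3 * (1 - 2 / (z 0 - z 1)) * (1 - 1 / ((z 0 - z 2) - 1)) * (1 - 1 / ((-(z 1 - z 2)) - 1)) := by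
      rw [cS2_eq, k01, k02, k12]
      norm_num only [if_true, if_false, one_mul, mul_one]
      try ring
    rw [this]
    simp only [Pf, kf3, kfm3, kf1, kfm1, kf2, kfm2, kf0]
    field_simp
    try ring
  have c8 : Pf (z 0) (z 1) (z 2) * cS2 ![1, 2, 0] z = 3 * kfm1 (z 0 - z 1) * kf1 (z 0 - z 2) * kf2 (z 1 - z 2) := by
    have : cS2 ![1, 2, 0] z = 3 * (1 - 1 / ((z 0 - z 2) - 1)) * (1 - 1 / ((-(z 0 - z 1)) - 1)) * (1 - 2 / (z 1 - z 2)) := by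
      rw [cS2_eq, k01, k02, k12]
      norm_num only [if_true, if_false, one_mul, mul_one]
      try ring
    rw [this]
    simp only [Pf, kf3, kfm3, kf1, kfm1, kf2, kfm2, kf0]
    field_simp
    try ring
  have c9 : Pf (z 0) (z 1) (z 2) * cS2 ![0, 2, 1] z = 3 * kfm2 (z 0 - z 1) * kfm1 (z 0 - z 2) * kf1 (z 1 - z 2) := by
    have : cS2 ![0, 2, 1] z = 3 * (1 - 2 / (-(z 0 - z 1))) * (1 - 1 / ((z 1 - z 2) - 1)) * (1 - 1 / ((-(z 0 - z 2)) - 1)) := by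
      rw [cS2_eq, k01, k02, k12]
      norm_num only [if_true, if_false, one_mul, mul_one]
      try ring
    rw [this]
    simp only [Pf, kf3, kfm3, kf1, kfm1, kf2, kfm2, kf0]
    field_simp
    try ring
  have c10 : Pf (z 0) (z 1) (z 2) * cS2 ![1, 0, 2] z = 3 * kf1 (z 0 - z 1) * kfm1 (z 0 - z 2) * kfm2 (z 1 - z 2) := by
    have : cS2 ![1, 0, 2] z = 3 * (1 - 1 / ((z 0 - z 1) - 1)) * (1 - 1 / ((-(z 0 - z 2)) - 1)) * (1 - 2 / (-(z 1 - z 2))) := by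
      rw [cS2_eq, k01, k02, k12]
      norm_num only [if_true, if_false, one_mul, mul_one]
      try ring
    rw [this]
    simp only [Pf, kf3, kfm3, kf1, kfm1, kf2, kfm2, kf0]
    field_simp
    try ring
  have c11 : Pf (z 0) (z 1) (z 2) * cS2 ![0, 1, 2] z = 3 * kfm1 (z 0 - z 1) * kfm2 (z 0 - z 2) * kfm1 (z 1 - z 2) := by
    have : cS2 ![0, 1, 2] z = 3 * (1 - 1 / ((-(z 0 - z 1)) - 1)) * (1 - 2 / (-(z 0 - z 2))) * (1 - 1 / ((-(z 1 - z 2)) - 1)) := by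
      rw [cS2_eq, k01, k02, k12]
      norm_num only [if_true, if_false, one_mul, mul_one]
      try ring
    rw [this]
    simp only [Pf, kf3, kfm3, kf1, kfm1, kf2, kfm2, kf0]
    field_simp
    try ring
  simp only [applyD0, S1, S2, List.map_cons, List.map_nil, List.sum_cons, List.sum_nil, hv, Nf]
  rw [← c0, ← c1, ← c2, ← c3, ← c4, ← c5, ← c6, ← c7, ← c8, ← c9, ← c10, ← c11]
  simp only [add_zero, ← sub_eq_add_neg]
  ring

section Final
open Filter Topology

theorem eq_zero_off_finite (h : ℂ → ℂ) (hc : Continuous h) (S : Set ℂ) (hS : S.Finite)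
    (h0 : ∀ t, t ∉ S → h t = 0) (t : ℂ) : h t = 0 := by
  have hd : Dense Sᶜ := hS.countable.dense_compl ℂ
  have := Continuous.ext_on hd hc (continuous_const (y := (0 : ℂ))) (fun t ht => h0 t ht)
  exact congrFun this t

/-- The linear form `z i - z j`. -/
noncomputable def linF (i j : Fin 3) : (Fin 3 → ℂ) →L[ℂ] ℂ :=
  ContinuousLinearMap.proj (R := ℂ) (φ := fun _ : Fin 3 => ℂ) i -
    ContinuousLinearMap.proj (R := ℂ) (φ := fun _ : Fin 3 => ℂ) j

theorem linF_apply (i j : Fin 3) (z : Fin 3 → ℂ) : linF i j z = z i - z j := rfl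

theorem exists_dir (i j i' j' : Fin 3) (h : i < j) (h' : i' < j') (hne : (i, j) ≠ (i', j')) :
    ∃ k : Fin 3, k ≠ i' ∧ k ≠ j' ∧ (k = i ∨ k = j) := by
  revert i j i' j'
  decide

theorem multi_div (L : List (Fin 3 × Fin 3 × ℂ)) (hlt : ∀ s ∈ L, s.1 < s.2.1) (hnd : L.Nodup) :
    ∀ f : (Fin 3 → ℂ) → ℂ, (∀ z, AnalyticAt ℂ f z) →
      (∀ s ∈ L, ∀ y : Fin 3 → ℂ, y s.1 - y s.2.1 = s.2.2 → f y = 0) →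
      ∃ g : (Fin 3 → ℂ) → ℂ, (∀ z, AnalyticAt ℂ g z) ∧
        ∀ y, f y = (L.map (fun s => y s.1 - y s.2.1 - s.2.2)).prod * g y := by
  induction L with
  | nil => intro f hf _; exact ⟨f, hf, by simp⟩
  | cons s L ih =>
    intro f hf h0
    obtain ⟨i, j, a⟩ := s
    have hij : i < j := hlt (i, j, a) (by simp)
    obtain ⟨g, hg, hfg⟩ := global_div f hf (linF i j) a (Pi.single i 1)
      (by rw [linF_apply]; simp [hij.ne'])
      (fun y hy => h0 (i, j, a) (by simp) y hy)
    have hgc : Continuous g := continuous_iff_continuousAt.2 fun z => (hg z).continuousAt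
    obtain ⟨q, hq, hgq⟩ := ih (fun s hs => hlt s (by simp [hs])) (List.nodup_cons.1 hnd).2 g hg (by
      rintro ⟨i', j', a'⟩ hs y hy
      simp only at hy
      have hf0 : ∀ y : Fin 3 → ℂ, y i' - y j' = a' → (y i - y j - a) * g y = 0 := by
        intro y hy
        have h1 := hfg y
        rw [h0 (i', j', a') (by simp [hs]) y hy] at h1
        exact h1.symm
      have hij' : i' < j' := hlt (i', j', a') (by simp [hs])
      by_cases hE : (i, j) = (i', j')
      · obtain ⟨rfl, rfl⟩ := Prod.mk.inj hE
        have ha : a' ≠ a := by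
          rintro rfl
          exact (List.nodup_cons.1 hnd).1 hs
        have := hf0 y hy
        rw [hy] at this
        exact (mul_eq_zero.1 this).resolve_left (sub_ne_zero.2 ha)
      · obtain ⟨k, k1, k2, k3⟩ := exists_dir i j i' j' hij hij' hE
        have hcont : Continuous fun t : ℂ => g (y + t • Pi.single k 1) := by fun_prop
        have hz : ∀ t : ℂ, ((y + t • (Pi.single k 1 : Fin 3 → ℂ)) i - (y + t • (Pi.single k 1 : Fin 3 → ℂ)) j - a) *
            g (y + t • Pi.single k 1) = 0 := by
          intro t
          apply hf0
          simp [k1.symm, k2.symm, hy]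
        have := eq_zero_off_finite _ hcont {a - (y i - y j), (y i - y j) - a} (by simp) (by
          intro t ht
          simp only [Set.mem_insert_iff, Set.mem_singleton_iff, not_or] at ht
          refine (mul_eq_zero.1 (hz t)).resolve_left ?_
          rcases k3 with rfl | rfl
          · simp [hij.ne']
            intro h
            exact ht.1 (by linear_combination h)
          · simp [hij.ne]
            intro h
            exact ht.2 (by linear_combination -h)) 0
        simpa using this)
    refine ⟨q, hq, fun y => ?_⟩
    rw [hfg, hgq, linF_apply]
    simp [mul_assoc]

theorem single_0 : (Pi.single 0 1 : Fin 3 → ℂ) = ![1, 0, 0] := by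
  ext i; fin_cases i <;> rfl

theorem single_1 : (Pi.single 1 1 : Fin 3 → ℂ) = ![0, 1, 0] := by
  ext i; fin_cases i <;> rfl

theorem single_2 : (Pi.single 2 1 : Fin 3 → ℂ) = ![0, 0, 1] := by
  ext i; fin_cases i <;> rfl

theorem vec_eta (z : Fin 3 → ℂ) : z = ![z 0, z 1, z 2] := by
  ext i; fin_cases i <;> rfl

theorem Pf_ne {a b c : ℂ} (h01 : a - b ≠ 0) (h01p : a - b - 1 ≠ 0) (h01m : a - b + 1 ≠ 0)
    (h02 : a - c ≠ 0) (h02p : a - c - 1 ≠ 0) (h02m : a - c + 1 ≠ 0)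
    (h12 : b - c ≠ 0) (h12p : b - c - 1 ≠ 0) (h12m : b - c + 1 ≠ 0) : Pf a b c ≠ 0 := by
  simp only [Pf, kf0]
  positivity

/-- Exceptional values of the third coordinate. -/
def excS (t : ℂ) : Set ℂ := {t + 1, t, t + 2, t - 1, t - 2}

theorem excS_finite (t : ℂ) : (excS t).Finite := by simp [excS]

theorem exc_ne {t c : ℂ} (h : c ∉ excS t) : t + 1 - c ≠ 0 ∧ t + 1 - c - 1 ≠ 0 ∧ t + 1 - c + 1 ≠ 0 ∧
    t - 1 - c ≠ 0 ∧ t - 1 - c - 1 ≠ 0 ∧ t - 1 - c + 1 ≠ 0 := by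
  simp only [excS, Set.mem_insert_iff, Set.mem_singleton_iff, not_or] at h
  obtain ⟨h1, h2, h3, h4, h5⟩ := h
  refine ⟨fun e => h1 ?_, fun e => h2 ?_, fun e => h3 ?_, fun e => h4 ?_, fun e => h5 ?_,
    fun e => h2 ?_⟩ <;> linear_combination -e

theorem exc_prod_ne {t c : ℂ} (h : c ∉ excS t) : kf0 (t + 1 - c) * kf0 (t - 1 - c) ≠ 0 := by
  obtain ⟨h1, h2, h3, h4, h5, h6⟩ := exc_ne h
  simp only [kf0]
  positivity

theorem cancel_aux {P A B N M : ℂ} (hP : P ≠ 0) (h1 : N = P * A) (h2 : M = -P * B) (h3 : N = -M) :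
    A - B = 0 := by
  have : P * (A - B) = 0 := by linear_combination -h1 - h2 + h3
  exact (mul_eq_zero.1 this).resolve_left hP

end Final

/-- The operator `D̃₀` preserves the ring `R^a_{A₂}`. -/
theorem stmt_17 (p : (Fin 3 → ℂ) → ℂ) (hp : RaA2 p) :
    ∃ q : (Fin 3 → ℂ) → ℂ, RaA2 q ∧
      ∀ z : Fin 3 → ℂ,
        (∀ i j : Fin 3, i ≠ j → z i - z j ≠ -1 ∧ z i - z j ≠ 0 ∧ z i - z j ≠ 1) →
        q z = applyD0 p z := by
  obtain ⟨han, hqi⟩ := hp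
  set F : ℂ → ℂ → ℂ → ℂ := fun a b c => p ![a, b, c] with hF
  have H01 : ∀ a b c a' b', a = b + 2 → a' = b → b' = a → F a b c = F a' b' c := by
    rintro a b c a' b' rfl rfl rfl
    have := hqi 0 1 (by decide) ![a' + 1, a' + 1, c] rfl
    have e1 : ![a' + 1, a' + 1, c] + Pi.single 0 1 - Pi.single 1 1 = ![a' + 2, a', c] := by
      simp only [single_0, single_1, single_2]
      ext i; fin_cases i <;> simp <;> ring
    have e2 : ![a' + 1, a' + 1, c] - Pi.single 0 1 + Pi.single 1 1 = ![a', a' + 2, c] := by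
      simp only [single_0, single_1, single_2]
      ext i; fin_cases i <;> simp <;> ring
    rwa [e1, e2] at this
  have H02 : ∀ a b c a' c', a = c + 2 → a' = c → c' = a → F a b c = F a' b c' := by
    rintro a b c a' c' rfl rfl rfl
    have := hqi 0 2 (by decide) ![a' + 1, b, a' + 1] rfl
    have e1 : ![a' + 1, b, a' + 1] + Pi.single 0 1 - Pi.single 2 1 = ![a' + 2, b, a'] := by
      simp only [single_0, single_1, single_2]
      ext i; fin_cases i <;> simp <;> ring
    have e2 : ![a' + 1, b, a' + 1] - Pi.single 0 1 + Pi.single 2 1 = ![a', b, a' + 2] := by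
      simp only [single_0, single_1, single_2]
      ext i; fin_cases i <;> simp <;> ring
    rwa [e1, e2] at this
  have H12 : ∀ a b c b' c', b = c + 2 → b' = c → c' = b → F a b c = F a b' c' := by
    rintro a b c b' c' rfl rfl rfl
    have := hqi 1 2 (by decide) ![a, b' + 1, b' + 1] rfl
    have e1 : ![a, b' + 1, b' + 1] + Pi.single 1 1 - Pi.single 2 1 = ![a, b' + 2, b'] := by
      simp only [single_0, single_1, single_2]
      ext i; fin_cases i <;> simp <;> ring
    have e2 : ![a, b' + 1, b' + 1] - Pi.single 1 1 + Pi.single 2 1 = ![a, b', b' + 2] := by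
      simp only [single_0, single_1, single_2]
      ext i; fin_cases i <;> simp <;> ring
    rwa [e1, e2] at this
  have hNan : ∀ z : Fin 3 → ℂ, AnalyticAt ℂ (fun z : Fin 3 → ℂ => Nf F (z 0) (z 1) (z 2)) z := by
    intro z
    have hpr : ∀ i : Fin 3, AnalyticAt ℂ (fun z : Fin 3 → ℂ => z i) z := fun i =>
      (ContinuousLinearMap.proj (R := ℂ) (φ := fun _ : Fin 3 => ℂ) i).analyticAt z
    have h0 := hpr 0
    have h1 := hpr 1
    have h2 := hpr 2
    have hFa : ∀ u v w : (Fin 3 → ℂ) → ℂ, AnalyticAt ℂ u z → AnalyticAt ℂ v z → AnalyticAt ℂ w z →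
        AnalyticAt ℂ (fun z => F (u z) (v z) (w z)) z := by
      intro u v w hu hv hw
      refine (han _).comp (f := fun z => ![u z, v z, w z]) (analyticAt_pi_iff.2 ?_)
      intro i
      fin_cases i
      · exact hu
      · exact hv
      · exact hw
    simp only [Nf, kf3, kfm3, kf1, kfm1, kf2, kfm2, kf0]
    have hs : ∀ (u : (Fin 3 → ℂ) → ℂ), AnalyticAt ℂ u z → ∀ r : ℂ,
        AnalyticAt ℂ (fun z => u z + r) z := fun u hu r => hu.add analyticAt_const
    have hs' : ∀ (u : (Fin 3 → ℂ) → ℂ), AnalyticAt ℂ u z → ∀ r : ℂ,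
        AnalyticAt ℂ (fun z => u z - r) z := fun u hu r => hu.sub analyticAt_const
    repeat' first
      | exact h0
      | exact h1
      | exact h2
      | exact analyticAt_const
      | apply AnalyticAt.fun_add
      | apply AnalyticAt.fun_mul
      | apply AnalyticAt.fun_sub
      | apply hFa
  obtain ⟨Q, hQan, hQ⟩ := multi_div
    [(0, 1, 0), (0, 1, 1), (0, 1, -1), (0, 2, 0), (0, 2, 1), (0, 2, -1),
      (1, 2, 0), (1, 2, 1), (1, 2, -1)]
    (by simp)
    (by
      have d1 : (0 : ℂ) ≠ 1 := by norm_num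
      have d2 : (0 : ℂ) ≠ -1 := by norm_num
      have d3 : (1 : ℂ) ≠ -1 := by norm_num
      simp [d1, d2, d3])
    (fun z : Fin 3 → ℂ => Nf F (z 0) (z 1) (z 2)) hNan
    (by
      intro s hs y hy
      simp only [List.mem_cons, List.not_mem_nil, or_false] at hs
      rcases hs with rfl | rfl | rfl | rfl | rfl | rfl | rfl | rfl | rfl <;>
        simp only at hy ⊢
      · rw [show y 0 = y 1 by linear_combination hy]; exact Nf_van_01_0 F H01 _ _
      · rw [show y 0 = y 1 + 1 by linear_combination hy]; exact Nf_van_01_1 F H01 _ _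
      · rw [show y 0 = y 1 - 1 by linear_combination hy]; exact Nf_van_01_m1 F H01 _ _
      · rw [show y 0 = y 2 by linear_combination hy]; exact Nf_van_02_0 F H02 _ _
      · rw [show y 0 = y 2 + 1 by linear_combination hy]; exact Nf_van_02_1 F H02 _ _
      · rw [show y 0 = y 2 - 1 by linear_combination hy]; exact Nf_van_02_m1 F H02 _ _
      · rw [show y 1 = y 2 by linear_combination hy]; exact Nf_van_12_0 F H12 _ _
      · rw [show y 1 = y 2 + 1 by linear_combination hy]; exact Nf_van_12_1 F H12 _ _
      · rw [show y 1 = y 2 - 1 by linear_combination hy]; exact Nf_van_12_m1 F H12 _ _)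
  have hNP : ∀ y : Fin 3 → ℂ, Nf F (y 0) (y 1) (y 2) = Pf (y 0) (y 1) (y 2) * Q y := by
    intro y
    rw [hQ y]
    simp only [List.map_cons, List.map_nil, List.prod_cons, List.prod_nil, Pf, kf0]
    ring
  have hNP' : ∀ a b c : ℂ, Nf F a b c = Pf a b c * Q ![a, b, c] := fun a b c => hNP ![a, b, c]
  have hQc : Continuous Q := continuous_iff_continuousAt.2 fun z => (hQan z).continuousAt
  have Q01 : ∀ t c : ℂ, Q ![t + 1, t - 1, c] - Q ![t - 1, t + 1, c] = 0 := by
    intro t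
    refine eq_zero_off_finite _ (by fun_prop) (excS t) (excS_finite t) fun c hc => ?_
    refine cancel_aux (P := Pf (t + 1) (t - 1) c) ?_ (hNP' _ _ _) (M := Nf F (t - 1) (t + 1) c) ?_
      (Nf_qi_01 F H01 t c)
    · have h := exc_prod_ne hc
      have e : Pf (t + 1) (t - 1) c = 6 * (kf0 (t + 1 - c) * kf0 (t - 1 - c)) := by
        simp only [Pf, kf0]; ring
      rw [e]
      exact mul_ne_zero (by norm_num) h
    · rw [hNP']
      congr 1
      simp only [Pf, kf0]; ring
  have Q02 : ∀ t c : ℂ, Q ![t + 1, c, t - 1] - Q ![t - 1, c, t + 1] = 0 := by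
    intro t
    refine eq_zero_off_finite _ (by fun_prop) (excS t) (excS_finite t) fun c hc => ?_
    refine cancel_aux (P := Pf (t + 1) c (t - 1)) ?_ (hNP' _ _ _) (M := Nf F (t - 1) c (t + 1)) ?_
      (Nf_qi_02 F H02 t c)
    · have h := exc_prod_ne hc
      have e : Pf (t + 1) c (t - 1) = (-6) * (kf0 (t + 1 - c) * kf0 (t - 1 - c)) := by
        simp only [Pf, kf0]; ring
      rw [e]
      exact mul_ne_zero (by norm_num) h
    · rw [hNP']
      congr 1
      simp only [Pf, kf0]; ring
  have Q12 : ∀ t c : ℂ, Q ![c, t + 1, t - 1] - Q ![c, t - 1, t + 1] = 0 := by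
    intro t
    refine eq_zero_off_finite _ (by fun_prop) (excS t) (excS_finite t) fun c hc => ?_
    refine cancel_aux (P := Pf c (t + 1) (t - 1)) ?_ (hNP' _ _ _) (M := Nf F c (t - 1) (t + 1)) ?_
      (Nf_qi_12 F H12 t c)
    · have h := exc_prod_ne hc
      have e : Pf c (t + 1) (t - 1) = 6 * (kf0 (t + 1 - c) * kf0 (t - 1 - c)) := by
        simp only [Pf, kf0]; ring
      rw [e]
      exact mul_ne_zero (by norm_num) h
    · rw [hNP']
      congr 1
      simp only [Pf, kf0]; ring
  have R01 : ∀ z : Fin 3 → ℂ, z 0 = z 1 →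
      Q (z + Pi.single 0 1 - Pi.single 1 1) = Q (z - Pi.single 0 1 + Pi.single 1 1) := by
    intro z hz
    have h := sub_eq_zero.1 (Q01 (z 1) (z 2))
    convert h using 2 <;> (simp only [single_0, single_1, single_2]; ext i; fin_cases i <;> simp [hz] <;>
      first | rfl | exact hz | exact hz.symm)
  have R02 : ∀ z : Fin 3 → ℂ, z 0 = z 2 →
      Q (z + Pi.single 0 1 - Pi.single 2 1) = Q (z - Pi.single 0 1 + Pi.single 2 1) := by
    intro z hz
    have h := sub_eq_zero.1 (Q02 (z 2) (z 1))
    convert h using 2 <;> (simp only [single_0, single_1, single_2]; ext i; fin_cases i <;> simp [hz] <;>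
      first | rfl | exact hz | exact hz.symm)
  have R12 : ∀ z : Fin 3 → ℂ, z 1 = z 2 →
      Q (z + Pi.single 1 1 - Pi.single 2 1) = Q (z - Pi.single 1 1 + Pi.single 2 1) := by
    intro z hz
    have h := sub_eq_zero.1 (Q12 (z 2) (z 0))
    convert h using 2 <;> (simp only [single_0, single_1, single_2]; ext i; fin_cases i <;> simp [hz] <;>
      first | rfl | exact hz | exact hz.symm)
  have swp : ∀ i j : Fin 3, (∀ z : Fin 3 → ℂ, z i = z j →
      Q (z + Pi.single i 1 - Pi.single j 1) = Q (z - Pi.single i 1 + Pi.single j 1)) →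
      ∀ z : Fin 3 → ℂ, z j = z i →
      Q (z + Pi.single j 1 - Pi.single i 1) = Q (z - Pi.single j 1 + Pi.single i 1) := by
    intro i j h z hz
    have := h z hz.symm
    rw [show z + Pi.single j 1 - Pi.single i 1 = z - Pi.single i 1 + Pi.single j 1 by abel,
      show z - Pi.single j 1 + Pi.single i 1 = z + Pi.single i 1 - Pi.single j 1 by abel]
    exact this.symm
  refine ⟨Q, ⟨hQan, ?_⟩, ?_⟩
  · intro i j hij
    fin_cases i <;> fin_cases j
    · exact absurd rfl hij
    · exact R01
    · exact R02
    · exact swp 0 1 R01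
    · exact absurd rfl hij
    · exact R12
    · exact swp 0 2 R02
    · exact swp 1 2 R12
    · exact absurd rfl hij
  · intro z hz
    have aux : ∀ i j : Fin 3, i ≠ j → z i - z j ≠ 0 ∧ z i - z j - 1 ≠ 0 ∧ z i - z j + 1 ≠ 0 := by
      intro i j hij
      obtain ⟨h1, h2, h3⟩ := hz i j hij
      exact ⟨h2, sub_ne_zero.2 h3, fun h => h1 (by linear_combination h)⟩
    obtain ⟨a1, a2, a3⟩ := aux 0 1 (by decide)
    obtain ⟨b1, b2, b3⟩ := aux 0 2 (by decide)
    obtain ⟨c1, c2, c3⟩ := aux 1 2 (by decide)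
    have h1 := hNP z
    rw [Nf_eq p z a1 a2 a3 b1 b2 b3 c1 c2 c3] at h1
    exact (mul_left_cancel₀ (Pf_ne a1 a2 a3 b1 b2 b3 c1 c2 c3) h1).symm

end
end

section
/- With the notation below: (i) for every p ∈ R^a_{A₁} there exist q₁, q₂ ∈ R^a_{A₁} such that q₁(z) = D₁p(z) for every z ∈ ℂ² with z₁ − z₂ ≠ −1, and q₂(z) = D₂p(z) for every z ∈ ℂ² with z₁ − z₂ ≠ 1 (so D₁ and D₂ preserve the ring R^a_{A₁}); (ii) the operators pairwise commute: for every function f : ℂ² → ℂ and every z ∈ ℂ² with z₁ − z₂ ∉ ℤ, one has D₁(D₂f)(z) = D₂(D₁f)(z), D₁(D^{msl}f)(z) = D^{msl}(D₁f)(z), and D₂(D^{msl}f)(z) = D^{msl}(D₂f)(z). -/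
noncomputable section

/-- The non-symmetric difference operator `D₁` for `A₁`. -/
def opD1 (f : ℂ × ℂ → ℂ) (z : ℂ × ℂ) : ℂ :=
  3 * (1 - 1 / (z.2 - z.1 - 1)) * f (z.1 + 1, z.2 + 2) +
    (1 - 3 / (z.1 - z.2 + 1)) * f (z.1 + 3, z.2)

/-- The non-symmetric difference operator `D₂` for `A₁`. -/
def opD2 (f : ℂ × ℂ → ℂ) (z : ℂ × ℂ) : ℂ :=
  3 * (1 - 1 / (z.1 - z.2 - 1)) * f (z.1 + 2, z.2 + 1) +
    (1 - 3 / (z.2 - z.1 + 1)) * f (z.1, z.2 + 3)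

/-- The Macdonald–Ruijsenaars operator `D^{msl}` for the minuscule weight of
the root system `2A₁` with multiplicity `1`. -/
def opMsl (f : ℂ × ℂ → ℂ) (z : ℂ × ℂ) : ℂ :=
  (1 - 2 / (z.1 - z.2)) * f (z.1 + 2, z.2) +
    (1 - 2 / (z.2 - z.1)) * f (z.1, z.2 + 2)

/-- The ring `R^a_{A₁}` of analytic quasi-invariants of type `A₁`. -/
def RaA1 (p : ℂ × ℂ → ℂ) : Prop :=
  (∀ z, AnalyticAt ℂ p z) ∧
  ∀ z : ℂ × ℂ, z.1 = z.2 → p (z.1 + 1, z.2 - 1) = p (z.1 - 1, z.2 + 1)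

theorem RaA1_swap {p : ℂ × ℂ → ℂ} (hp : RaA1 p) : RaA1 (fun z => p (z.2, z.1)) := by
  refine ⟨fun z => ?_, fun z hz => ?_⟩
  · exact (hp.1 _).comp (f := fun z : ℂ × ℂ => (z.2, z.1)) (analyticAt_snd.prod analyticAt_fst)
  · exact (hp.2 (z.2, z.1) hz.symm).symm

section Division
open Topology Filter

variable {E : Type*} [NormedAddCommGroup E] [NormedSpace ℂ E]

/-- Telescoping for a multilinear map. -/
theorem telescope {m : ℕ} (g : ContinuousMultilinearMap ℂ (fun _ : Fin (m + 1) => E) ℂ)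
    (y y' : E) :
    g (fun _ => y) - g (fun _ => y') =
      ∑ k : Fin (m + 1), g (k.insertNth (y - y') (fun i : Fin m => if i.castSucc < k then y else y')) := by
  set a : ℕ → ℂ := fun k => g (fun i => if i.val < k then y else y') with ha
  have h0 : a 0 = g (fun _ => y') := by simp [ha]
  have h1 : a (m + 1) = g (fun _ => y) := by simp only [ha, Fin.is_lt, if_true]
  rw [← h0, ← h1, ← Finset.sum_range_sub, Finset.sum_range]
  refine Finset.sum_congr rfl fun k _ => ?_
  have hu : ∀ x : E, k.insertNth (α := fun _ => E) x (fun i : Fin m => if i.castSucc < k then y else y')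
      = Function.update (fun i : Fin (m + 1) => if i.val < k then y else y') k x := by
    intro x
    rw [eq_comm, Fin.eq_insertNth_iff]
    refine ⟨by simp, ?_⟩
    funext i
    simp only [Fin.removeNth, Function.update_of_ne (Fin.succAbove_ne k i)]
    congr 1
    rw [← Fin.lt_def, Fin.succAbove_lt_iff_castSucc_lt]
  rw [hu, g.map_update_sub]
  simp only [ha]
  congr 2
  · funext i
    rcases eq_or_ne i k with rfl | h
    · simp
    · have : i.val ≠ k.val := fun h' => h (Fin.ext h')
      simp [h]
      congr 1
      simp; omega
  · funext i
    rcases eq_or_ne i k with rfl | h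
    · simp
    · simp [h]

/-- The divided series. -/
def divSeries (p : FormalMultilinearSeries ℂ E ℂ) (P : E →L[ℂ] E) (v : E) :
    FormalMultilinearSeries ℂ E ℂ := fun m =>
  ∑ k : Fin (m + 1), ((p (m + 1)).curryMid k v).compContinuousLinearMap
    (fun i : Fin m => if i.castSucc < k then ContinuousLinearMap.id ℂ E else P)

theorem divSeries_apply (p : FormalMultilinearSeries ℂ E ℂ) (ℓ : E →L[ℂ] ℂ) (P : E →L[ℂ] E) (v : E)
    (hP : ∀ y, y - P y = ℓ y • v) (m : ℕ) (y : E) :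
    ℓ y * divSeries p P v m (fun _ => y) = p (m + 1) (fun _ => y) - p (m + 1) (fun _ => P y) := by
  rw [telescope, divSeries, _root_.sum_apply, Finset.mul_sum]
  refine Finset.sum_congr rfl fun k _ => ?_
  rw [hP, ← ContinuousMultilinearMap.curryMid_apply, map_smul]
  simp only [_root_.smul_apply, smul_eq_mul,
    ContinuousMultilinearMap.compContinuousLinearMap_apply]
  congr 3
  funext i
  split_ifs <;> simp

theorem divSeries_radius (p : FormalMultilinearSeries ℂ E ℂ) (P : E →L[ℂ] E) (v : E)
    (hp : 0 < p.radius) : 0 < (divSeries p P v).radius := by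
  obtain ⟨C, r, hC, hr, h⟩ := p.le_mul_pow_of_radius_pos hp
  set B : ℝ := max 1 ‖P‖ with hB
  have hB1 : 1 ≤ B := le_max_left _ _
  have key : ∀ m, ‖divSeries p P v m‖ ≤ (C * r * ‖v‖) * (2 * r * B) ^ m := by
    intro m
    have h2 : ∀ k : Fin (m + 1), ‖((p (m + 1)).curryMid k v).compContinuousLinearMap
        (fun i : Fin m => if i.castSucc < k then ContinuousLinearMap.id ℂ E else P)‖
        ≤ (C * r ^ (m + 1) * ‖v‖) * B ^ m := by
      intro k
      refine (ContinuousMultilinearMap.norm_compContinuousLinearMap_le _ _).trans ?_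
      gcongr
      · refine (((p (m + 1)).curryMid k).le_opNorm v).trans ?_
        gcongr
        rw [ContinuousMultilinearMap.norm_curryMid]
        exact h _
      · refine (Finset.prod_le_prod (g := fun _ => B) (fun _ _ => norm_nonneg _) ?_).trans (by simp)
        intro i _
        split_ifs
        · exact ContinuousLinearMap.norm_id_le.trans hB1
        · exact le_max_right _ _
    refine (norm_sum_le_of_le _ fun k _ => h2 k).trans ?_
    have h3 : ((m + 1 : ℕ) : ℝ) ≤ 2 ^ m := by exact_mod_cast Nat.lt_two_pow_self
    simp only [Finset.sum_const, Finset.card_univ, Fintype.card_fin, nsmul_eq_mul]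
    calc _ ≤ 2 ^ m * ((C * r ^ (m + 1) * ‖v‖) * B ^ m) := by gcongr
      _ = _ := by ring
  have hA : 0 < 2 * r * B := by positivity
  refine lt_of_lt_of_le ?_ ((divSeries p P v).le_radius_of_bound (C * r * ‖v‖)
    (r := Real.toNNReal (2 * r * B)⁻¹) ?_)
  · rw [ENNReal.coe_pos, Real.toNNReal_pos]
    exact inv_pos.2 hA
  · intro n
    rw [Real.coe_toNNReal _ (inv_pos.2 hA).le]
    calc _ ≤ (C * r * ‖v‖) * (2 * r * B) ^ n * ((2 * r * B)⁻¹) ^ n := by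
          exact mul_le_mul_of_nonneg_right (key n) (by positivity)
      _ = _ := by rw [mul_assoc, ← mul_pow, mul_inv_cancel₀ hA.ne', one_pow, mul_one]

theorem local_division (g : E → ℂ) (x : E) (hg : AnalyticAt ℂ g x) (ℓ : E →L[ℂ] ℂ) (v : E)
    (hv : ℓ v = 1) (h0 : ∀ y, ℓ y = 0 → g (x + y) = 0) :
    ∃ h : E → ℂ, AnalyticAt ℂ h x ∧ ∀ᶠ z in 𝓝 x, g z = ℓ (z - x) * h z := by
  obtain ⟨p, hp⟩ := hg
  set P : E →L[ℂ] E := ContinuousLinearMap.id ℂ E - ℓ.smulRight v with hPdef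
  have hP : ∀ y, y - P y = ℓ y • v := by intro y; simp [hPdef]
  have hPl : ∀ y, ℓ (P y) = 0 := by intro y; simp [hPdef, hv]
  have hr := divSeries_radius p P v hp.radius_pos
  have hq := (divSeries p P v).hasFPowerSeriesOnBall hr
  refine ⟨fun z => (divSeries p P v).sum (z - x), ?_, ?_⟩
  · have := hq.comp_sub x
    rw [zero_add] at this
    exact this.analyticAt
  · have t : Tendsto (fun z => z - x) (𝓝 x) (𝓝 0) := by
      have : ContinuousAt (fun z => z - x) x := by fun_prop
      simpa [ContinuousAt] using this
    have t2 : Tendsto (fun z => P (z - x)) (𝓝 x) (𝓝 0) := by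
      have : ContinuousAt (fun z => P (z - x)) x := by fun_prop
      simpa [ContinuousAt] using this
    have e1 := hp.eventually_hasSum
    have e2 := hq.hasFPowerSeriesAt.eventually_hasSum
    filter_upwards [t.eventually e1, t2.eventually e1, t.eventually e2] with z s1 s2 s3
    rw [h0 _ (hPl _)] at s2
    have s4 := (hasSum_nat_add_iff' 1).2 (s1.sub s2)
    have s5 := s3.mul_left (ℓ (z - x))
    simp only [divSeries_apply p ℓ P v hP, zero_add] at s5
    have h6 := s4.unique s5
    have h7 : p 0 (fun _ => z - x) = p 0 (fun _ => P (z - x)) := by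
      congr 1; funext i; exact i.elim0
    rw [Finset.sum_range_one, h7, sub_self, sub_zero, sub_zero, add_sub_cancel] at h6
    exact h6

theorem global_division (g : E → ℂ) (hg : ∀ x, AnalyticAt ℂ g x) (ℓ : E →L[ℂ] ℂ) (v : E)
    (hv : ℓ v = 1) (c : ℂ) (h0 : ∀ z, ℓ z = c → g z = 0) :
    ∃ h : E → ℂ, (∀ x, AnalyticAt ℂ h x) ∧ ∀ z, g z = (ℓ z - c) * h z := by
  classical
  refine ⟨fun z => if ℓ z = c then fderiv ℂ g z v else g z / (ℓ z - c), fun x => ?_, fun z => ?_⟩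
  · by_cases hx : ℓ x = c
    · obtain ⟨h, ha, he⟩ := local_division g x (hg x) ℓ v hv
        (fun y hy => h0 _ (by simp [hx, hy]))
      refine ha.congr ?_
      filter_upwards [he.eventually_nhds, ha.eventually_analyticAt] with z hz haz
      have hzx : ∀ w, ℓ (w - x) = ℓ w - c := by intro w; simp [hx]
      split_ifs with hzc
      · have hz' : g =ᶠ[𝓝 z] fun w => (ℓ w - c) * h w := by
          filter_upwards [hz] with w hw
          rw [hw, hzx]
        have hd : HasFDerivAt (fun w => (ℓ w - c) * h w) ((ℓ z - c) • fderiv ℂ h z + h z • ℓ) z :=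
          (ℓ.hasFDerivAt.sub_const c).mul haz.differentiableAt.hasFDerivAt
        rw [hz'.fderiv_eq, hd.fderiv]
        simp [hzc, hv]
      · have := hz.self_of_nhds
        rw [this, hzx, mul_div_cancel_left₀ _ (sub_ne_zero.2 hzc)]
    · have : AnalyticAt ℂ (fun z => g z / (ℓ z - c)) x :=
        (hg x).div ((ℓ.analyticAt x).sub analyticAt_const) (sub_ne_zero.2 hx)
      refine this.congr ?_
      have : ∀ᶠ z in 𝓝 x, ℓ z ≠ c := ℓ.continuous.continuousAt.eventually_ne hx
      filter_upwards [this] with z hz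
      simp [hz]
  · by_cases hz : ℓ z = c
    · simp [h0 z hz, hz]
    · simp only [hz, if_false]
      rw [mul_div_cancel₀ _ (sub_ne_zero.2 hz)]

end Division

theorem opD1_preserves (p : ℂ × ℂ → ℂ) (hp : RaA1 p) :
    ∃ q₁ : ℂ × ℂ → ℂ, RaA1 q₁ ∧ ∀ z : ℂ × ℂ, z.1 - z.2 ≠ -1 → q₁ z = opD1 p z := by
  have a1 : ∀ z, AnalyticAt ℂ (fun z : ℂ × ℂ => p (z.1 + 1, z.2 + 2)) z := fun z =>
    (hp.1 _).comp (f := fun z : ℂ × ℂ => (z.1 + 1, z.2 + 2))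
      ((analyticAt_fst.add analyticAt_const).prod (analyticAt_snd.add analyticAt_const))
  have a2 : ∀ z, AnalyticAt ℂ (fun z : ℂ × ℂ => p (z.1 + 3, z.2)) z := fun z =>
    (hp.1 _).comp (f := fun z : ℂ × ℂ => (z.1 + 3, z.2))
      ((analyticAt_fst.add analyticAt_const).prod analyticAt_snd)
  obtain ⟨h, ha, hh⟩ := global_division (fun z : ℂ × ℂ => p (z.1 + 1, z.2 + 2) - p (z.1 + 3, z.2))
    (fun z => (a1 z).sub (a2 z))
    (ContinuousLinearMap.fst ℂ ℂ ℂ - ContinuousLinearMap.snd ℂ ℂ ℂ) (1, 0) (by simp) (-1) (by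
      rintro ⟨a, b⟩ hz
      have hb : b = a + 1 := by simp at hz; linear_combination -hz
      subst hb
      have := hp.2 (a + 2, a + 2) rfl
      simp only at this ⊢
      rw [sub_eq_zero]
      convert this.symm using 3 <;> ring)
  have main : ∀ z : ℂ × ℂ, z.1 - z.2 ≠ -1 →
      3 * p (z.1 + 1, z.2 + 2) + p (z.1 + 3, z.2) + 3 * h z = opD1 p z := by
    rintro ⟨a, b⟩ hz
    have h1 := hh (a, b)
    simp at h1 hz
    have n1 : a - b + 1 ≠ 0 := fun h => hz (by linear_combination h)
    have n2 : b - a - 1 ≠ 0 := fun h => hz (by linear_combination -h)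
    have h2 : h (a, b) = (p (a + 1, b + 2) - p (a + 3, b)) / (a - b + 1) := by
      rw [h1]; field_simp
    have h3 : b - a - 1 = -(a - b + 1) := by ring
    simp only [opD1]
    rw [h2, h3]
    field_simp
    ring
  refine ⟨fun z => 3 * p (z.1 + 1, z.2 + 2) + p (z.1 + 3, z.2) + 3 * h z, ⟨fun z => ?_, ?_⟩, main⟩
  · exact ((analyticAt_const.mul (a1 z)).add (a2 z)).add (analyticAt_const.mul (ha z))
  · rintro ⟨a, b⟩ hab
    simp only at hab
    subst hab
    have m1 := main (a + 1, a - 1) (by simp; ring_nf; norm_num)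
    have m2 := main (a - 1, a + 1) (by simp; ring_nf; norm_num)
    simp only at m1 m2 ⊢
    rw [m1, m2]
    simp only [opD1]
    ring_nf

theorem opD1_eq (f : ℂ × ℂ → ℂ) (x y w : ℂ) (h : x - y = w) : opD1 f (x, y) =
    3 * (1 + 1 / (w + 1)) * f (x + 1, y + 2) + (1 - 3 / (w + 1)) * f (x + 3, y) := by
  subst h
  have : y - x - 1 = -(x - y + 1) := by ring
  simp only [opD1]
  rw [this, div_neg, sub_neg_eq_add]

theorem opD2_eq (f : ℂ × ℂ → ℂ) (x y w : ℂ) (h : x - y = w) : opD2 f (x, y) =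
    3 * (1 - 1 / (w - 1)) * f (x + 2, y + 1) + (1 + 3 / (w - 1)) * f (x, y + 3) := by
  subst h
  have : y - x + 1 = -(x - y - 1) := by ring
  simp only [opD2]
  rw [this, div_neg, sub_neg_eq_add]

theorem opMsl_eq (f : ℂ × ℂ → ℂ) (x y w : ℂ) (h : x - y = w) : opMsl f (x, y) =
    (1 - 2 / w) * f (x + 2, y) + (1 + 2 / w) * f (x, y + 2) := by
  subst h
  have : y - x = -(x - y) := by ring
  simp only [opMsl]
  rw [this, div_neg, sub_neg_eq_add]

/-- The operators `D₁` and `D₂` preserve the ring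
`R^a_{A₁}`, and the operators `D₁`, `D₂`, `D^{msl}` pairwise commute. -/
theorem stmt_18 :
    (∀ p : ℂ × ℂ → ℂ, RaA1 p →
      (∃ q₁ : ℂ × ℂ → ℂ, RaA1 q₁ ∧
        ∀ z : ℂ × ℂ, z.1 - z.2 ≠ -1 → q₁ z = opD1 p z) ∧
      (∃ q₂ : ℂ × ℂ → ℂ, RaA1 q₂ ∧
        ∀ z : ℂ × ℂ, z.1 - z.2 ≠ 1 → q₂ z = opD2 p z)) ∧
    (∀ f : ℂ × ℂ → ℂ, ∀ z : ℂ × ℂ, (∀ k : ℤ, z.1 - z.2 ≠ (k : ℂ)) →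
      opD1 (opD2 f) z = opD2 (opD1 f) z ∧
      opD1 (opMsl f) z = opMsl (opD1 f) z ∧
      opD2 (opMsl f) z = opMsl (opD2 f) z) := by
  refine ⟨fun p hp => ⟨opD1_preserves p hp, ?_⟩, fun f z hz => ?_⟩
  · obtain ⟨q, hq, h⟩ := opD1_preserves _ (RaA1_swap hp)
    refine ⟨_, RaA1_swap hq, fun z hz => ?_⟩
    rw [h _ (by intro h0; apply hz; simp at h0; linear_combination -h0)]
    simp [opD1, opD2]
  obtain ⟨a, b⟩ := z
  simp only at hz
  set w := a - b with hw
  have n0 : w ≠ 0 := by simpa using hz 0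
  have n1 : w + 1 ≠ 0 := fun h => hz (-1) (by push_cast; linear_combination h)
  have n2 : w + 2 ≠ 0 := fun h => hz (-2) (by push_cast; linear_combination h)
  have n3 : w + 3 ≠ 0 := fun h => hz (-3) (by push_cast; linear_combination h)
  have n4 : w + 4 ≠ 0 := fun h => hz (-4) (by push_cast; linear_combination h)
  have m1 : w - 1 ≠ 0 := fun h => hz 1 (by push_cast; linear_combination h)
  have m2 : w - 2 ≠ 0 := fun h => hz 2 (by push_cast; linear_combination h)
  have m3 : w - 3 ≠ 0 := fun h => hz 3 (by push_cast; linear_combination h)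
  have m4 : w - 4 ≠ 0 := fun h => hz 4 (by push_cast; linear_combination h)
  have k1 : w - 1 - 1 = w - 2 := by ring
  have k2 : w + 3 - 1 = w + 2 := by ring
  have k3 : w + 1 + 1 = w + 2 := by ring
  have k4 : w - 3 + 1 = w - 2 := by ring
  have k5 : w + 2 + 1 = w + 3 := by ring
  have k6 : w - 2 + 1 = w - 1 := by ring
  have k7 : w + 2 - 1 = w + 1 := by ring
  have k8 : w - 2 - 1 = w - 3 := by ring
  refine ⟨?_, ?_, ?_⟩
  · rw [opD1_eq _ a b w rfl, opD2_eq _ _ _ (w - 1) (by rw [hw]; ring),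
      opD2_eq _ _ _ (w + 3) (by rw [hw]; ring), opD2_eq _ a b w rfl,
      opD1_eq _ _ _ (w + 1) (by rw [hw]; ring), opD1_eq _ _ _ (w - 3) (by rw [hw]; ring)]
    simp only [k1, k2, k3, k4, k5, k6, k7, k8]
    simp only [add_assoc]
    norm_num only
    field_simp
    ring
  · rw [opD1_eq _ a b w rfl, opMsl_eq _ _ _ (w - 1) (by rw [hw]; ring),
      opMsl_eq _ _ _ (w + 3) (by rw [hw]; ring), opMsl_eq _ a b w rfl,
      opD1_eq _ _ _ (w + 2) (by rw [hw]; ring), opD1_eq _ _ _ (w - 2) (by rw [hw]; ring)]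
    simp only [k1, k2, k3, k4, k5, k6, k7, k8]
    simp only [add_assoc]
    norm_num only
    field_simp
    ring
  · rw [opD2_eq _ a b w rfl, opMsl_eq _ _ _ (w + 1) (by rw [hw]; ring),
      opMsl_eq _ _ _ (w - 3) (by rw [hw]; ring), opMsl_eq _ a b w rfl,
      opD2_eq _ _ _ (w + 2) (by rw [hw]; ring), opD2_eq _ _ _ (w - 2) (by rw [hw]; ring)]
    simp only [k1, k2, k3, k4, k5, k6, k7, k8]
    simp only [add_assoc]
    norm_num only
    field_simp
    ring

end
end

section
/- With the notation below, let f : ℂ² → ℂ satisfy f(z₁+t, z₂+t) = f(z₁,z₂) for all t, z₁, z₂ ∈ ℂ (f is constant along the direction (1,1)). Then for every z ∈ ℂ² with z₁ − z₂ ∉ ℤ: (i) D̂₀(D̂₀f)(z) = E(E(Ef))(z), where D̂₀ = D₁ + D₂ and Ef = D^{msl}f + 2f; (ii) D₁(D₂f)(z) = 3·D^{msl}(D^{msl}f)(z) + 4f(z); (iii) D₁(D₂f)(z) = 3·D^{qm}f(z) + 16f(z). -/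
noncomputable section

/-- The operator `D^{qm}` for the quasiminuscule weight. -/
def opQm (f : ℂ × ℂ → ℂ) (z : ℂ × ℂ) : ℂ :=
  (1 - 2 / (z.1 - z.2)) * (1 - 2 / (z.1 - z.2 + 2)) * (f (z.1 + 4, z.2) - f z) +
    (1 - 2 / (z.2 - z.1)) * (1 - 2 / (z.2 - z.1 + 2)) * (f (z.1, z.2 + 4) - f z)

/-- The operator `D̂₀ = D₁ + D₂`. -/
def opD0 (f : ℂ × ℂ → ℂ) (z : ℂ × ℂ) : ℂ := opD1 f z + opD2 f z

/-- The operator `E = D^{msl} + 2`. -/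
def opE (f : ℂ × ℂ → ℂ) (z : ℂ × ℂ) : ℂ := opMsl f z + 2 * f z

/-- One-variable form of `opD1`. -/
def oneD1 (g : ℂ → ℂ) (x : ℂ) : ℂ :=
  3 * (1 + 1 / (x + 1)) * g (x - 1) + (1 - 3 / (x + 1)) * g (x + 3)

/-- One-variable form of `opD2`. -/
def oneD2 (g : ℂ → ℂ) (x : ℂ) : ℂ :=
  3 * (1 - 1 / (x - 1)) * g (x + 1) + (1 + 3 / (x - 1)) * g (x - 3)

/-- One-variable form of `opMsl`. -/
def oneMsl (g : ℂ → ℂ) (x : ℂ) : ℂ :=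
  (1 - 2 / x) * g (x + 2) + (1 + 2 / x) * g (x - 2)

/-- One-variable form of `opQm`. -/
def oneQm (g : ℂ → ℂ) (x : ℂ) : ℂ :=
  (1 - 2 / x) * (1 - 2 / (x + 2)) * (g (x + 4) - g x) + (1 + 2 / x) * (1 + 2 / (x - 2)) * (g (x - 4) - g x)

/-- One-variable form of `opD0`. -/
def oneD0 (g : ℂ → ℂ) (x : ℂ) : ℂ :=
  3 * (1 + 1 / (x + 1)) * g (x - 1) + (1 - 3 / (x + 1)) * g (x + 3) + (3 * (1 - 1 / (x - 1)) * g (x + 1) + (1 + 3 / (x - 1)) * g (x - 3))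

/-- One-variable form of `opE`. -/
def oneE (g : ℂ → ℂ) (x : ℂ) : ℂ :=
  (1 - 2 / x) * g (x + 2) + (1 + 2 / x) * g (x - 2) + 2 * g x

lemma aux_D1 (g : ℂ → ℂ) : opD1 (fun w => g (w.1 - w.2)) =
    fun w => oneD1 g (w.1 - w.2) := by
  funext w
  have h : w.2 - w.1 - 1 = -(w.1 - w.2 + 1) := by ring
  simp only [opD1, oneD1, h, div_neg, sub_neg_eq_add]
  congr 3 <;> ring

lemma aux_D2 (g : ℂ → ℂ) : opD2 (fun w => g (w.1 - w.2)) =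
    fun w => oneD2 g (w.1 - w.2) := by
  funext w
  have h : w.2 - w.1 + 1 = -(w.1 - w.2 - 1) := by ring
  simp only [opD2, oneD2, h, div_neg, sub_neg_eq_add]
  congr 3 <;> ring

lemma aux_Msl (g : ℂ → ℂ) : opMsl (fun w => g (w.1 - w.2)) =
    fun w => oneMsl g (w.1 - w.2) := by
  funext w
  have h : w.2 - w.1 = -(w.1 - w.2) := by ring
  simp only [opMsl, oneMsl, h, div_neg, sub_neg_eq_add]
  congr 3 <;> ring

lemma aux_Qm (g : ℂ → ℂ) : opQm (fun w => g (w.1 - w.2)) =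
    fun w => oneQm g (w.1 - w.2) := by
  funext w
  have h : w.2 - w.1 = -(w.1 - w.2) := by ring
  have h' : w.2 - w.1 + 2 = -(w.1 - w.2 - 2) := by ring
  have h4 : w.1 + 4 - w.2 = w.1 - w.2 + 4 := by ring
  have h5 : w.1 - (w.2 + 4) = w.1 - w.2 - 4 := by ring
  simp only [opQm, oneQm, h', h4, h5]
  simp only [h, div_neg, sub_neg_eq_add]

lemma aux_D0 (g : ℂ → ℂ) : opD0 (fun w => g (w.1 - w.2)) =
    fun w => oneD0 g (w.1 - w.2) := by
  funext w
  simp only [opD0, oneD0, aux_D1, aux_D2, oneD1, oneD2]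

lemma aux_E (g : ℂ → ℂ) : opE (fun w => g (w.1 - w.2)) =
    fun w => oneE g (w.1 - w.2) := by
  funext w
  simp only [opE, oneE, aux_Msl, oneMsl]

/-- On functions constant along the direction `(1,1)`:
`D̂₀² = (D^{msl} + 2)³`, and `D₁D₂ = 3(D^{msl})² + 4 = 3D^{qm} + 16`. -/
theorem stmt_19 (f : ℂ × ℂ → ℂ)
    (hf : ∀ t z₁ z₂ : ℂ, f (z₁ + t, z₂ + t) = f (z₁, z₂)) :
    ∀ z : ℂ × ℂ, (∀ k : ℤ, z.1 - z.2 ≠ (k : ℂ)) →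
      opD0 (fun w => opD0 f w) z = opE (fun w => opE (fun v => opE f v) w) z ∧
      opD1 (fun w => opD2 f w) z = 3 * opMsl (fun w => opMsl f w) z + 4 * f z ∧
      opD1 (fun w => opD2 f w) z = 3 * opQm f z + 16 * f z := by
  intro z hz
  obtain ⟨g, rfl⟩ : ∃ g : ℂ → ℂ, f = fun w => g (w.1 - w.2) := by
    refine ⟨fun x => f (x, 0), ?_⟩
    funext w
    have := hf w.2 (w.1 - w.2) 0
    simpa using this
  clear hf
  simp only [aux_D0, aux_E, aux_D1, aux_D2, aux_Msl, aux_Qm]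
  generalize z.1 - z.2 = x at hz
  have h0 : x ≠ 0 := by simpa using hz 0
  have ha (n : ℕ) : x + n ≠ 0 := fun h => hz (-n) (by push_cast; linear_combination h)
  have hb (n : ℕ) : x - n ≠ 0 := fun h => hz n (by push_cast; linear_combination h)
  have a1 : x + 1 ≠ 0 := by simpa using ha 1
  have a2 : x + 2 ≠ 0 := by simpa using ha 2
  have a4 : x + 4 ≠ 0 := by simpa using ha 4
  have b1 : x - 1 ≠ 0 := by simpa using hb 1
  have b2 : x - 2 ≠ 0 := by simpa using hb 2
  have b4 : x - 4 ≠ 0 := by simpa using hb 4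
  have p1 : x + 1 + 1 = x + 2 := by ring
  have p2 : x + 1 + 3 = x + 4 := by ring
  have p3 : x + 3 + 1 = x + 4 := by ring
  have p4 : x + 3 + 3 = x + 6 := by ring
  have p5 : x + 2 + 2 = x + 4 := by ring
  have p6 : x + 4 + 2 = x + 6 := by ring
  have m1 : x - 1 - 1 = x - 2 := by ring
  have m2 : x - 1 - 3 = x - 4 := by ring
  have m3 : x - 3 - 1 = x - 4 := by ring
  have m4 : x - 3 - 3 = x - 6 := by ring
  have m5 : x - 2 - 2 = x - 4 := by ring
  have m6 : x - 4 - 2 = x - 6 := by ring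
  have q1 : x + 1 - 1 = x := by ring
  have q2 : x + 1 - 3 = x - 2 := by ring
  have q3 : x + 3 - 1 = x + 2 := by ring
  have q4 : x + 3 - 3 = x := by ring
  have q5 : x + 2 - 2 = x := by ring
  have q6 : x + 4 - 2 = x + 2 := by ring
  have r1 : x - 1 + 1 = x := by ring
  have r2 : x - 1 + 3 = x + 2 := by ring
  have r3 : x - 3 + 1 = x - 2 := by ring
  have r4 : x - 3 + 3 = x := by ring
  have r5 : x - 2 + 2 = x := by ring
  have r6 : x - 4 + 2 = x - 2 := by ring
  simp only [oneD0, oneE, oneD1, oneD2, oneMsl, oneQm, p1, p2, p3, p4, p5, p6, m1, m2, m3, m4, m5, m6, q1, q2, q3, q4, q5, q6, r1, r2, r3, r4, r5, r6]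
  generalize g (x + 6) = g6
  generalize g (x + 4) = g4
  generalize g (x + 2) = g2
  generalize g (x - 6) = k6
  generalize g (x - 4) = k4
  generalize g (x - 2) = k2
  generalize g x = g0
  refine ⟨?_, ?_, ?_⟩
  · field_simp
    ring
  · field_simp
    ring
  · field_simp
    ring

end
end
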